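/- arXiv:1706.01873 — 2 statements merged into one kernel-verified Lean document; each statement's English description precedes it below -/
import Mathlib

section
/- Suppose k ∈ ℝ and B(x,s₂) is compactly contained in an open set Ω ⊂ X, and assume either that (a) u is a 1-subminimizer in Ω, or (b) Ω is bounded, u is a solution of the K_{ψ,f}(Ω)-obstacle problem, and ψ ≤ k a.e. in B(x,s₂). Then for every 0 < s₁ < s₂, one has the De Giorgi-type inequality ‖D(u−k)₊‖(B(x,s₁)) ≤ (2/(s₂−s₁)) ∫_{B(x,s₂)} (u−k)₊ dμ, where (u−k)₊ = max{u−k, 0}. -/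
open MeasureTheory Metric Filter Set
open scoped ENNReal NNReal Topology

noncomputable section

namespace MetricBV

variable {X : Type*} [MetricSpace X] [MeasurableSpace X]

/-- A rectifiable curve, encoded as a Lipschitz map on the interval `[0,1]`
(every rectifiable curve admits such a reparametrization). -/
structure Curve (X : Type*) [MetricSpace X] where
  toFun : ℝ → X
  lipschitz : ∃ K : ℝ≥0, LipschitzOnWith K toFun (Set.Icc 0 1)

/-- The metric speed of a curve at a point. -/
def speed (γ : ℝ → X) (t : ℝ) : ℝ≥0∞ :=
  Filter.limsup (fun h : ℝ => ENNReal.ofReal (dist (γ (t + h)) (γ t) / |h|)) (𝓝[≠] (0 : ℝ))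

/-- The curve integral `∫_γ g ds`. -/
def curveIntegral (g : X → ℝ≥0∞) (γ : Curve X) : ℝ≥0∞ :=
  ∫⁻ t in Set.Icc (0 : ℝ) 1, g (γ.toFun t) * speed γ.toFun t

/-- A curve lies in a set `Ω`. -/
def Curve.In (γ : Curve X) (Ω : Set X) : Prop :=
  ∀ t ∈ Set.Icc (0 : ℝ) 1, γ.toFun t ∈ Ω

/-- The 1-modulus of a family of curves. -/
def Mod1 (μ : Measure X) (Γ : Set (Curve X)) : ℝ≥0∞ :=
  ⨅ (ρ : X → ℝ≥0∞) (_ : Measurable ρ) (_ : ∀ γ ∈ Γ, 1 ≤ curveIntegral ρ γ),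
    ∫⁻ x, ρ x ∂μ

/-- `g` is an upper gradient of `u` in `Ω`: the upper gradient inequality holds
along every curve contained in `Ω`. -/
def IsUpperGradientOn (g : X → ℝ≥0∞) (u : X → ℝ) (Ω : Set X) : Prop :=
  ∀ γ : Curve X, γ.In Ω →
    ENNReal.ofReal |u (γ.toFun 1) - u (γ.toFun 0)| ≤ curveIntegral g γ

/-- `g` is a 1-weak upper gradient of `u` in `Ω`: the upper gradient inequality holds
along every curve in `Ω` outside a family of zero 1-modulus. -/
def IsWeakUpperGradientOn (μ : Measure X) (g : X → ℝ≥0∞) (u : X → ℝ) (Ω : Set X) : Prop :=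
  ∃ Γ : Set (Curve X), Mod1 μ Γ = 0 ∧
    ∀ γ : Curve X, γ ∉ Γ → γ.In Ω →
      ENNReal.ofReal |u (γ.toFun 1) - u (γ.toFun 0)| ≤ curveIntegral g γ

/-- Membership in the Newtonian space `N^{1,1}(X)`. -/
def MemN11 (μ : Measure X) (u : X → ℝ) : Prop :=
  Integrable u μ ∧ ∃ g : X → ℝ≥0∞, Measurable g ∧
    IsWeakUpperGradientOn μ g u Set.univ ∧ ∫⁻ x, g x ∂μ < ⊤

/-- The 1-capacity `cap₁(A) = inf ‖u‖_{N^{1,1}(X)}` over `u ∈ N^{1,1}(X)` with `u ≥ 1` on `A`. -/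
def cap1 (μ : Measure X) (A : Set X) : ℝ≥0∞ :=
  ⨅ (u : X → ℝ) (_ : MemN11 μ u) (_ : ∀ x ∈ A, 1 ≤ u x)
    (g : X → ℝ≥0∞) (_ : Measurable g) (_ : IsWeakUpperGradientOn μ g u Set.univ),
    (∫⁻ x, ENNReal.ofReal |u x| ∂μ + ∫⁻ x, g x ∂μ)

/-- The variational 1-capacity `cap₁(A,Ω) = inf ∫ g_u dμ` over `u ∈ N^{1,1}(X)` with
`u ≥ 1` on `A` and `u = 0` on `X ∖ Ω`. -/
def vcap1 (μ : Measure X) (A Ω : Set X) : ℝ≥0∞ :=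
  ⨅ (u : X → ℝ) (_ : MemN11 μ u) (_ : ∀ x ∈ A, 1 ≤ u x) (_ : ∀ x ∈ Ωᶜ, u x = 0)
    (g : X → ℝ≥0∞) (_ : Measurable g) (_ : IsWeakUpperGradientOn μ g u Set.univ),
    ∫⁻ x, g x ∂μ

/-- Locally Lipschitz in `Ω`: Lipschitz on every compact subset of `Ω`. -/
def LocLipschitzOn (u : X → ℝ) (Ω : Set X) : Prop :=
  ∀ K : Set X, IsCompact K → K ⊆ Ω → ∃ L : ℝ≥0, LipschitzOnWith L u K

/-- Convergence `v i → u` in `L¹_loc(Ω)`. -/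
def TendstoL1Loc (μ : Measure X) (v : ℕ → X → ℝ) (u : X → ℝ) (Ω : Set X) : Prop :=
  ∀ K : Set X, IsCompact K → K ⊆ Ω →
    Filter.Tendsto (fun i => ∫⁻ x in K, ENNReal.ofReal |v i x - u x| ∂μ)
      Filter.atTop (𝓝 0)

/-- The total variation `‖Du‖(Ω)` of `u` in an open set `Ω`: the infimum of
`liminf ∫_Ω g_i dμ` over sequences of locally Lipschitz functions `v i → u` in `L¹_loc(Ω)`
with `g i` a 1-weak upper gradient of `v i` in `Ω`. -/
def tv (μ : Measure X) (u : X → ℝ) (Ω : Set X) : ℝ≥0∞ :=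
  ⨅ (v : ℕ → X → ℝ) (_ : ∀ i, LocLipschitzOn (v i) Ω) (_ : TendstoL1Loc μ v u Ω)
    (g : ℕ → X → ℝ≥0∞) (_ : ∀ i, Measurable (g i))
    (_ : ∀ i, IsWeakUpperGradientOn μ (g i) (v i) Ω),
    Filter.liminf (fun i => ∫⁻ x in Ω, g i x ∂μ) Filter.atTop

/-- The total variation `‖Du‖(A)` for an arbitrary set `A`. -/
def tvs (μ : Measure X) (u : X → ℝ) (A : Set X) : ℝ≥0∞ :=
  ⨅ (U : Set X) (_ : IsOpen U) (_ : A ⊆ U), tv μ u U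

/-- The characteristic function of a set, as a real-valued function. -/
def chi (E : Set X) : X → ℝ := Set.indicator E fun _ => (1 : ℝ)

/-- The perimeter `P(E,Ω) = ‖Dχ_E‖(Ω)` of `E` in an open set `Ω`. -/
def perim (μ : Measure X) (E : Set X) (Ω : Set X) : ℝ≥0∞ := tv μ (chi E) Ω

/-- `u ∈ BV(Ω)`: `u ∈ L¹(Ω)` and `‖Du‖(Ω) < ∞`. -/
def MemBV (μ : Measure X) (u : X → ℝ) (Ω : Set X) : Prop :=
  IntegrableOn u Ω μ ∧ tv μ u Ω < ⊤

/-- `u ∈ BV_loc(Ω)`. -/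
def MemBVloc (μ : Measure X) (u : X → ℝ) (Ω : Set X) : Prop :=
  ∀ K : Set X, IsCompact K → K ⊆ Ω → ∃ U : Set X, IsOpen U ∧ K ⊆ U ∧ U ⊆ Ω ∧ MemBV μ u U

/-- `φ ∈ BV_c(Ω)`: a BV function with compact support in `Ω`. -/
def MemBVc (μ : Measure X) (φ : X → ℝ) (Ω : Set X) : Prop :=
  MemBV μ φ Ω ∧ IsCompact (tsupport φ) ∧ tsupport φ ⊆ Ω

/-- `u` is a 1-minimizer (function of least gradient) in `Ω`. -/
def IsMinimizer (μ : Measure X) (u : X → ℝ) (Ω : Set X) : Prop :=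
  MemBVloc μ u Ω ∧ ∀ φ : X → ℝ, MemBVc μ φ Ω →
    tvs μ u (tsupport φ) ≤ tvs μ (fun y => u y + φ y) (tsupport φ)

/-- `u` is a 1-superminimizer in `Ω`. -/
def IsSuperminimizer (μ : Measure X) (u : X → ℝ) (Ω : Set X) : Prop :=
  MemBVloc μ u Ω ∧ ∀ φ : X → ℝ, MemBVc μ φ Ω → (∀ x, 0 ≤ φ x) →
    tvs μ u (tsupport φ) ≤ tvs μ (fun y => u y + φ y) (tsupport φ)

/-- `u` is a 1-subminimizer in `Ω`. -/
def IsSubminimizer (μ : Measure X) (u : X → ℝ) (Ω : Set X) : Prop :=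
  MemBVloc μ u Ω ∧ ∀ φ : X → ℝ, MemBVc μ φ Ω → (∀ x, φ x ≤ 0) →
    tvs μ u (tsupport φ) ≤ tvs μ (fun y => u y + φ y) (tsupport φ)

/-- The lower approximate limit `u^∧(x)`, with values in `[-∞,∞]`. -/
def lowerApprox (μ : Measure X) (u : X → ℝ) (x : X) : EReal :=
  sSup ((fun t : ℝ => (t : EReal)) '' {t : ℝ | Filter.Tendsto
    (fun r : ℝ => μ ({y | u y < t} ∩ Metric.ball x r) / μ (Metric.ball x r))
    (𝓝[>] (0 : ℝ)) (𝓝 0)})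

/-- The upper approximate limit `u^∨(x)`, with values in `[-∞,∞]`. -/
def upperApprox (μ : Measure X) (u : X → ℝ) (x : X) : EReal :=
  sInf ((fun t : ℝ => (t : EReal)) '' {t : ℝ | Filter.Tendsto
    (fun r : ℝ => μ ({y | t < u y} ∩ Metric.ball x r) / μ (Metric.ball x r))
    (𝓝[>] (0 : ℝ)) (𝓝 0)})

/-- The upper approximate limit of an extended-real-valued function. -/
def upperApproxE (μ : Measure X) (ψ : X → EReal) (x : X) : EReal :=
  sInf ((fun t : ℝ => (t : EReal)) '' {t : ℝ | Filter.Tendsto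
    (fun r : ℝ => μ ({y | (t : EReal) < ψ y} ∩ Metric.ball x r) / μ (Metric.ball x r))
    (𝓝[>] (0 : ℝ)) (𝓝 0)})

/-- The measure-theoretic interior `I_E`. -/
def measInterior (μ : Measure X) (E : Set X) : Set X :=
  {x : X | Filter.Tendsto (fun r : ℝ => μ (Metric.ball x r \ E) / μ (Metric.ball x r))
    (𝓝[>] (0 : ℝ)) (𝓝 0)}

/-- The measure-theoretic boundary `∂*E`. -/
def measBoundary (μ : Measure X) (E : Set X) : Set X :=
  {x : X | 0 < Filter.limsup (fun r : ℝ => μ (Metric.ball x r ∩ E) / μ (Metric.ball x r))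
      (𝓝[>] (0 : ℝ)) ∧
    0 < Filter.limsup (fun r : ℝ => μ (Metric.ball x r \ E) / μ (Metric.ball x r))
      (𝓝[>] (0 : ℝ))}

/-- `A` is 1-thin at `x`. -/
def IsThinAt (μ : Measure X) (A : Set X) (x : X) : Prop :=
  Filter.Tendsto (fun r : ℝ =>
      ENNReal.ofReal r * vcap1 μ (A ∩ Metric.ball x r) (Metric.ball x (2 * r))
        / μ (Metric.ball x r))
    (𝓝[>] (0 : ℝ)) (𝓝 0)

/-- `U` is 1-finely open. -/
def IsFinelyOpen (μ : Measure X) (U : Set X) : Prop :=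
  ∀ x ∈ U, IsThinAt μ Uᶜ x

/-- The class `K_{ψ,f}(Ω)` of admissible functions for the obstacle problem. -/
def MemK (μ : Measure X) (ψ : X → EReal) (f : X → ℝ) (Ω : Set X) (u : X → ℝ) : Prop :=
  MemBVloc μ u Set.univ ∧ (∀ᵐ x ∂μ, x ∈ Ω → ψ x ≤ (u x : EReal)) ∧
    (∀ᵐ x ∂μ, x ∉ Ω → u x = f x)

/-- `u` is a solution of the `K_{ψ,f}(Ω)`-obstacle problem. -/
def IsObstacleSolution (μ : Measure X) (ψ : X → EReal) (f : X → ℝ) (Ω : Set X)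
    (u : X → ℝ) : Prop :=
  MemK μ ψ f Ω u ∧ ∀ v : X → ℝ, MemK μ ψ f Ω v → tv μ u Set.univ ≤ tv μ v Set.univ

/-- The standing assumptions: `(X,d,μ)` is a complete metric space with at least two points,
`μ` is a doubling measure with constant `Cd`, and `X` supports a `(1,1)`-Poincaré inequality
with constants `CP`, `lam`. -/
structure MMS {X : Type*} [MetricSpace X] [MeasurableSpace X] (μ : Measure X)
    (Cd CP lam : ℝ) : Prop where
  complete : CompleteSpace X
  nontrivial : Nontrivial X
  hCd : 1 ≤ Cd
  hCP : 0 < CP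
  hlam : 1 ≤ lam
  doubling : ∀ (x : X) (r : ℝ), 0 < r →
    0 < μ (Metric.ball x (2 * r)) ∧
    μ (Metric.ball x (2 * r)) ≤ ENNReal.ofReal Cd * μ (Metric.ball x r) ∧
    μ (Metric.ball x r) < ⊤
  poincare : ∀ (x : X) (r : ℝ), 0 < r → ∀ u : X → ℝ, MeasureTheory.LocallyIntegrable u μ →
    ∀ g : X → ℝ≥0∞, Measurable g → IsUpperGradientOn g u Set.univ →
      ∫⁻ y in Metric.ball x r, ENNReal.ofReal |u y - ⨍ z in Metric.ball x r, u z ∂μ| ∂μ ≤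
        ENNReal.ofReal (CP * r) * (μ (Metric.ball x r) / μ (Metric.ball x (lam * r))) *
          ∫⁻ y in Metric.ball x (lam * r), g y ∂μ

section

set_option linter.unusedSectionVars false

/-! ### Curves and their metric speed -/

theorem speed_congr {γ γ' : ℝ → X} {t : ℝ} (h : γ =ᶠ[𝓝 t] γ') : speed γ t = speed γ' t := by
  have hmap : Tendsto (fun r : ℝ => t + r) (𝓝[≠] 0) (𝓝 t) := by
    have : Tendsto (fun r : ℝ => t + r) (𝓝 0) (𝓝 (t + 0)) := by
      exact (continuous_const.add continuous_id).tendsto 0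
    rw [add_zero] at this
    exact this.mono_left nhdsWithin_le_nhds
  refine limsup_congr ?_
  filter_upwards [hmap.eventually h] with r hr
  rw [hr, h.eq_of_nhds]

theorem speed_eq_zero_of_eventually_const {γ : ℝ → X} {t : ℝ} {p : X}
    (h : γ =ᶠ[𝓝 t] fun _ => p) : speed γ t = 0 := by
  rw [speed_congr h]
  simp [speed]

/-- The distance between two points of a curve is at most the length of the arc joining them. -/
theorem ofReal_dist_le_lintegral_speed (γ : Curve X) {s t : ℝ} (hs : 0 ≤ s) (hst : s ≤ t)
    (ht : t ≤ 1) :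
    ENNReal.ofReal (dist (γ.toFun t) (γ.toFun s)) ≤ ∫⁻ τ in Ioo s t, speed γ.toFun τ := by
  obtain ⟨K, hK⟩ := γ.lipschitz
  set d : ℝ → ℝ := fun τ => dist (γ.toFun τ) (γ.toFun s) with hd
  have hLip : LipschitzOnWith K d (uIcc s t) := by
    rw [uIcc_of_le hst]
    have h1 : LipschitzOnWith K γ.toFun (Icc s t) := hK.mono (Icc_subset_Icc hs ht)
    have h2 := (LipschitzWith.dist_left (γ.toFun s)).comp_lipschitzOnWith h1
    rw [one_mul] at h2
    exact h2
  have hac := hLip.absolutelyContinuousOnInterval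
  have hint := hac.integral_deriv_eq_sub
  have hds : d s = 0 := by simp [hd]
  have hle : ENNReal.ofReal (d t) ≤ ∫⁻ τ in Ioc s t, ENNReal.ofReal |deriv d τ| := by
    have h1 : d t = ∫ τ in Ioc s t, deriv d τ := by
      rw [← intervalIntegral.integral_of_le hst, hint, hds, sub_zero]
    have h2 := enorm_integral_le_lintegral_enorm (μ := volume.restrict (Ioc s t)) (deriv d)
    rw [← h1, Real.enorm_eq_ofReal dist_nonneg] at h2
    simpa only [Real.enorm_eq_ofReal_abs] using h2
  refine hle.trans ?_
  rw [setLIntegral_congr Ioo_ae_eq_Ioc.symm]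
  refine lintegral_mono_ae ?_
  rw [ae_restrict_iff' measurableSet_Ioo]
  filter_upwards [hac.ae_differentiableAt] with τ hτ hτI
  have hdiff := hτ (by rw [uIcc_of_le hst]; exact Ioo_subset_Icc_self hτI)
  have hlim := (hasDerivAt_iff_tendsto_slope_zero.1 hdiff.hasDerivAt).abs
  have hlim2 : Tendsto (fun r : ℝ => ENNReal.ofReal |r⁻¹ • (d (τ + r) - d τ)|) (𝓝[≠] 0)
      (𝓝 (ENNReal.ofReal |deriv d τ|)) := ENNReal.tendsto_ofReal hlim
  rw [← hlim2.limsup_eq]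
  refine limsup_le_limsup (Eventually.of_forall fun r => ?_)
  refine ENNReal.ofReal_le_ofReal ?_
  rw [smul_eq_mul, abs_mul, abs_inv, div_eq_inv_mul]
  exact mul_le_mul_of_nonneg_left (abs_dist_sub_le _ _ _) (by positivity)

/-- The curve `γ` stopped outside the parameter interval `[s, t]`. -/
def Curve.clamp (γ : Curve X) {s t : ℝ} (hs : 0 ≤ s) (hst : s ≤ t) (ht : t ≤ 1) : Curve X where
  toFun τ := γ.toFun (max s (min τ t))
  lipschitz := by
    obtain ⟨K, hK⟩ := γ.lipschitz
    refine ⟨K * 1, hK.comp (g := γ.toFun) (f := fun τ => max s (min τ t)) (s := Icc 0 1) ?_ ?_⟩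
    · exact ((LipschitzWith.id.min_const t).const_max s).lipschitzOnWith
    · intro τ _
      exact ⟨hs.trans (le_max_left _ _), max_le (hst.trans ht) ((min_le_right _ _).trans ht)⟩

theorem curveIntegral_clamp_le (g : X → ℝ≥0∞) (γ : Curve X) {s t : ℝ} (hs : 0 ≤ s)
    (hst : s ≤ t) (ht : t ≤ 1) :
    curveIntegral g (γ.clamp hs hst ht) ≤
      ∫⁻ τ in Ioo s t, g (γ.toFun τ) * speed γ.toFun τ := by
  rw [← lintegral_indicator measurableSet_Ioo]
  refine (setLIntegral_le_lintegral _ _).trans (lintegral_mono_ae ?_)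
  have h1 : ∀ᵐ τ : ℝ, τ ≠ s := by simp [ae_iff]
  have h2 : ∀ᵐ τ : ℝ, τ ≠ t := by simp [ae_iff]
  filter_upwards [h1, h2] with τ hτs hτt
  rcases lt_or_gt_of_ne hτs with hs' | hs'
  · have : (γ.clamp hs hst ht).toFun =ᶠ[𝓝 τ] fun _ => γ.toFun s := by
      filter_upwards [Iio_mem_nhds hs'] with r hr
      have : max s (min r t) = s := max_eq_left ((min_le_left _ _).trans (le_of_lt hr))
      simp only [Curve.clamp, this]
    rw [speed_eq_zero_of_eventually_const this, mul_zero]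
    exact zero_le
  rcases lt_or_gt_of_ne hτt with ht' | ht'
  · have : (γ.clamp hs hst ht).toFun =ᶠ[𝓝 τ] γ.toFun := by
      filter_upwards [Ioo_mem_nhds hs' ht'] with r hr
      have : max s (min r t) = r := by rw [min_eq_left hr.2.le, max_eq_right hr.1.le]
      simp only [Curve.clamp, this]
    rw [speed_congr this, this.eq_of_nhds, indicator_of_mem (show τ ∈ Ioo s t from ⟨hs', ht'⟩)]
  · have : (γ.clamp hs hst ht).toFun =ᶠ[𝓝 τ] fun _ => γ.toFun t := by
      filter_upwards [Ioi_mem_nhds ht'] with r hr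
      have : max s (min r t) = t := by rw [min_eq_right (le_of_lt hr), max_eq_right hst]
      simp only [Curve.clamp, this]
    rw [speed_eq_zero_of_eventually_const this, mul_zero]
    exact zero_le

/-- The upper gradient inequality for `g` and `u` along all arcs of `γ` contained in `U`. -/
def IsUpperGradientAlong (g : X → ℝ≥0∞) (u : X → ℝ) (U : Set X) (γ : Curve X) : Prop :=
  ∀ s t : ℝ, 0 ≤ s → s ≤ t → t ≤ 1 → (∀ τ ∈ Icc s t, γ.toFun τ ∈ U) →
    ENNReal.ofReal |u (γ.toFun t) - u (γ.toFun s)| ≤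
      ∫⁻ τ in Ioo s t, g (γ.toFun τ) * speed γ.toFun τ

/-- A weak upper gradient satisfies the upper gradient inequality along all arcs of almost
every curve. -/
theorem IsWeakUpperGradientOn.exists_along {μ : Measure X} {g : X → ℝ≥0∞} {u : X → ℝ} {U : Set X}
    (h : IsWeakUpperGradientOn μ g u U) :
    ∃ Γ : Set (Curve X), Mod1 μ Γ = 0 ∧ ∀ γ ∉ Γ, IsUpperGradientAlong g u U γ := by
  obtain ⟨Γ, hΓ, hug⟩ := h
  refine ⟨{γ | ∃ (s t : ℝ) (hs : 0 ≤ s) (hst : s ≤ t) (ht : t ≤ 1), γ.clamp hs hst ht ∈ Γ}, ?_, ?_⟩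
  · refine le_antisymm ?_ zero_le
    rw [← hΓ]
    refine le_iInf fun ρ => le_iInf fun hρ => le_iInf fun hadm => ?_
    refine iInf_le_of_le ρ (iInf_le_of_le hρ (iInf_le_of_le ?_ le_rfl))
    rintro γ ⟨s, t, hs, hst, ht, hγ⟩
    refine (hadm _ hγ).trans ((curveIntegral_clamp_le ρ γ hs hst ht).trans ?_)
    exact lintegral_mono_set fun τ hτ => ⟨hs.trans hτ.1.le, hτ.2.le.trans ht⟩
  · intro γ hγ s t hs hst ht hU
    have hmem : γ.clamp hs hst ht ∉ Γ := fun hc => hγ ⟨s, t, hs, hst, ht, hc⟩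
    have hin : (γ.clamp hs hst ht).In U := fun τ _ =>
      hU _ ⟨le_max_left _ _, max_le hst (min_le_right _ _)⟩
    have := (hug _ hmem hin).trans (curveIntegral_clamp_le g γ hs hst ht)
    have e1 : (γ.clamp hs hst ht).toFun 1 = γ.toFun t := by
      simp only [Curve.clamp, min_eq_right ht, max_eq_right hst]
    have e0 : (γ.clamp hs hst ht).toFun 0 = γ.toFun s := by
      simp only [Curve.clamp, min_eq_left (hs.trans hst), max_eq_left hs]
    rwa [e1, e0] at this

theorem Mod1_union_eq_zero {μ : Measure X} {Γ₁ Γ₂ : Set (Curve X)} (h₁ : Mod1 μ Γ₁ = 0)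
    (h₂ : Mod1 μ Γ₂ = 0) : Mod1 μ (Γ₁ ∪ Γ₂) = 0 := by
  refine le_antisymm (ENNReal.le_of_forall_pos_le_add fun ε hε _ => ?_) zero_le
  have hε2 : (0 : ℝ≥0∞) < ε / 2 := ENNReal.div_pos (by exact_mod_cast hε.ne') (by simp)
  have H : ∀ Γ : Set (Curve X), Mod1 μ Γ = 0 → ∃ ρ : X → ℝ≥0∞, Measurable ρ ∧
      (∀ γ ∈ Γ, 1 ≤ curveIntegral ρ γ) ∧ ∫⁻ x, ρ x ∂μ < ε / 2 := by
    intro Γ hΓ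
    rw [← hΓ] at hε2
    simpa only [Mod1, iInf_lt_iff, exists_prop] using hε2
  obtain ⟨ρ₁, m₁, a₁, i₁⟩ := H Γ₁ h₁
  obtain ⟨ρ₂, m₂, a₂, i₂⟩ := H Γ₂ h₂
  have hmono : ∀ ρ ρ' : X → ℝ≥0∞, (∀ x, ρ x ≤ ρ' x) → ∀ γ : Curve X,
      curveIntegral ρ γ ≤ curveIntegral ρ' γ := fun ρ ρ' h γ =>
    lintegral_mono fun τ => mul_le_mul_left (h _) _
  have hle : (∀ γ ∈ Γ₁ ∪ Γ₂, 1 ≤ curveIntegral (fun x => ρ₁ x + ρ₂ x) γ) →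
      Mod1 μ (Γ₁ ∪ Γ₂) ≤ ∫⁻ x, (ρ₁ x + ρ₂ x) ∂μ := fun h =>
    iInf_le_of_le (fun x => ρ₁ x + ρ₂ x) (iInf_le_of_le (m₁.add m₂) (iInf_le_of_le h le_rfl))
  refine (hle ?_).trans ?_
  · rintro γ (hγ | hγ)
    · exact (a₁ γ hγ).trans (hmono _ _ (fun x => le_self_add) γ)
    · exact (a₂ γ hγ).trans (hmono _ _ (fun x => le_add_self) γ)
  · rw [lintegral_add_left m₁, zero_add]
    calc _ ≤ (ε / 2 + ε / 2 : ℝ≥0∞) := add_le_add i₁.le i₂.le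
      _ = ε := ENNReal.add_halves _

/-- A local bound of the increments of a function by the integral of `ρ` is a global bound. -/
theorem ofReal_abs_sub_le_lintegral_of_local {h : ℝ → ℝ} {ρ : ℝ → ℝ≥0∞}
    (H : ∀ t₀ ∈ Icc (0 : ℝ) 1, ∃ N ∈ 𝓝 t₀, ∀ s t, 0 ≤ s → s ≤ t → t ≤ 1 → Icc s t ⊆ N →
      ENNReal.ofReal |h t - h s| ≤ ∫⁻ τ in Ioo s t, ρ τ) :
    ENNReal.ofReal |h 1 - h 0| ≤ ∫⁻ τ in Icc (0 : ℝ) 1, ρ τ := by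
  choose! N hN hloc using H
  obtain ⟨p, hp0, hpm, ⟨m, hm⟩, hpc⟩ := exists_monotone_Icc_subset_open_cover_Icc
    (zero_le_one (α := ℝ)) (c := fun t₀ : Icc (0 : ℝ) 1 => Subtype.val ⁻¹' interior (N t₀))
    (fun t₀ => isOpen_interior.preimage continuous_subtype_val)
    (fun t₀ _ => mem_iUnion.2 ⟨t₀, mem_interior_iff_mem_nhds.2 (hN _ t₀.2)⟩)
  have key : ∀ n, ENNReal.ofReal |h (p n) - h 0| ≤ ∫⁻ τ in Ioc (0 : ℝ) (p n), ρ τ := by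
    intro n
    induction n with
    | zero => simp [hp0]
    | succ n ih =>
      obtain ⟨t₀, ht₀⟩ := hpc n
      have hle : (p n : ℝ) ≤ p (n + 1) := hpm n.le_succ
      have hstep := hloc t₀ t₀.2 (p n) (p (n + 1)) (p n).2.1 hle (p (n + 1)).2.2 (by
        intro τ hτ
        exact interior_subset (ht₀ (show (⟨τ, (p n).2.1.trans hτ.1, hτ.2.trans (p (n + 1)).2.2⟩ :
          Icc (0 : ℝ) 1) ∈ Icc (p n) (p (n + 1)) from ⟨hτ.1, hτ.2⟩)))
      rw [setLIntegral_congr Ioo_ae_eq_Ioc] at hstep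
      rw [← Ioc_union_Ioc_eq_Ioc (p n).2.1 hle, lintegral_union measurableSet_Ioc
        (Ioc_disjoint_Ioc_of_le le_rfl)]
      refine le_trans ?_ (add_le_add ih hstep)
      rw [← ENNReal.ofReal_add (abs_nonneg _) (abs_nonneg _)]
      refine ENNReal.ofReal_le_ofReal ?_
      have := abs_add_le (h (p n) - h 0) (h (p (n + 1)) - h (p n))
      rwa [sub_add_sub_comm, add_comm (h (p n)), add_sub_add_right_eq_sub] at this
  have := key m
  rw [hm m le_rfl] at this
  exact this.trans (lintegral_mono_set Ioc_subset_Icc_self)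

theorem Curve.continuousOn (γ : Curve X) : ContinuousOn γ.toFun (Icc 0 1) :=
  γ.lipschitz.choose_spec.continuousOn

/-- A function that is continuous on an open set varies by at most `ε` along arcs of a curve
near a given parameter. -/
theorem Curve.exists_nhds_forall_abs_sub_lt (γ : Curve X) {U : Set X} (hU : IsOpen U) {u : X → ℝ}
    (hu : ContinuousOn u U) {t₀ : ℝ} (ht₀ : t₀ ∈ Icc (0 : ℝ) 1) (h : γ.toFun t₀ ∈ U) {ε : ℝ}
    (hε : 0 < ε) : ∃ N ∈ 𝓝 t₀, ∀ τ ∈ N ∩ Icc 0 1, γ.toFun τ ∈ U ∧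
      |u (γ.toFun τ) - u (γ.toFun t₀)| < ε := by
  have h1 : Tendsto γ.toFun (𝓝[Icc 0 1] t₀) (𝓝 (γ.toFun t₀)) := γ.continuousOn t₀ ht₀
  have h2 : ∀ᶠ y in 𝓝 (γ.toFun t₀), y ∈ U ∧ |u y - u (γ.toFun t₀)| < ε := by
    have := (hu.continuousAt (hU.mem_nhds h)).eventually (Metric.ball_mem_nhds _ hε)
    filter_upwards [hU.mem_nhds h, this] with y h₁ h₂ using ⟨h₁, h₂⟩
  obtain ⟨N, hN, hN'⟩ := mem_nhdsWithin_iff_exists_mem_nhds_inter.1 (h1.eventually h2)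
  exact ⟨N, hN, fun τ hτ => hN' hτ⟩

variable {μ : Measure X}

/-! ### Locally Lipschitz functions and weak upper gradients -/

theorem LocLipschitzOn.continuousOn {u : X → ℝ} {U : Set X} (h : LocLipschitzOn u U) :
    ContinuousOn u U := by
  intro x hx
  refine tendsto_of_seq_tendsto fun y hyx => ?_
  obtain ⟨hy, hyU⟩ := tendsto_nhdsWithin_iff.1 hyx
  obtain ⟨N, hN⟩ := eventually_atTop.1 hyU
  have hy' : Tendsto (fun n => y (n + N)) atTop (𝓝 x) := (tendsto_add_atTop_iff_nat N).2 hy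
  obtain ⟨L, hL⟩ := h _ hy'.isCompact_insert_range (by
    rintro z (rfl | ⟨n, rfl⟩)
    · exact hx
    · exact hN _ (Nat.le_add_left _ _))
  have hc := hL.continuousOn x (mem_insert _ _)
  refine (tendsto_add_atTop_iff_nat N).1 (hc.tendsto.comp (tendsto_nhdsWithin_iff.2 ⟨hy', ?_⟩))
  exact Eventually.of_forall fun n => mem_insert_of_mem _ ⟨n, rfl⟩

theorem LocLipschitzOn.mono {u : X → ℝ} {U V : Set X} (h : LocLipschitzOn u U) (hV : V ⊆ U) :
    LocLipschitzOn u V := fun K hK hKV => h K hK (hKV.trans hV)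

theorem LocLipschitzOn.comp_lipschitz {u : X → ℝ} {U : Set X} (h : LocLipschitzOn u U)
    {F : ℝ → ℝ} {L : ℝ≥0} (hF : LipschitzWith L F) : LocLipschitzOn (fun y => F (u y)) U := by
  intro K hK hKU
  obtain ⟨M, hM⟩ := h K hK hKU
  exact ⟨L * M, hF.comp_lipschitzOnWith hM⟩

theorem LocLipschitzOn.add {u v : X → ℝ} {U : Set X} (hu : LocLipschitzOn u U)
    (hv : LocLipschitzOn v U) : LocLipschitzOn (fun y => u y + v y) U := by
  intro K hK hKU
  obtain ⟨M, hM⟩ := hu K hK hKU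
  obtain ⟨N, hN⟩ := hv K hK hKU
  exact ⟨M + N, hM.add hN⟩

/-- Interpolating between `a` and `b` by a cutoff `ξ` supported where `a` is controlled. -/
theorem LocLipschitzOn.interpolate {ξ a b : X → ℝ} {L : ℝ≥0} (hξ : LipschitzWith L ξ)
    (h0 : ∀ y, 0 ≤ ξ y) (h1 : ∀ y, ξ y ≤ 1) {U W : Set X} (hTU : tsupport ξ ⊆ U)
    (hUW : U ⊆ W) (ha : LocLipschitzOn a U) (hb : LocLipschitzOn b W) :
    LocLipschitzOn (fun y => ξ y * a y + (1 - ξ y) * b y) W := by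
  have hd : LocLipschitzOn (fun y => a y + -b y) U :=
    ha.add ((hb.mono hUW).comp_lipschitz LipschitzWith.id.neg)
  have hprod : LocLipschitzOn (fun y => ξ y * (a y - b y)) W := by
    intro K hK _
    have hKT : IsCompact (K ∩ tsupport ξ) := hK.inter_right (isClosed_tsupport ξ)
    obtain ⟨A, hA⟩ := hd _ hKT (inter_subset_right.trans hTU)
    obtain ⟨M, hM⟩ := hKT.exists_bound_of_continuousOn hA.continuousOn
    have hM0 : ∀ y ∈ K ∩ tsupport ξ, |a y - b y| ≤ M.toNNReal := fun y hy => by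
      have := hM y hy
      rw [Real.norm_eq_abs] at this
      rw [show a y - b y = a y + -b y by ring]
      exact this.trans (Real.le_coe_toNNReal M)
    have key : ∀ y ∈ K ∩ tsupport ξ, ∀ z ∈ K, |ξ y * (a y - b y) - ξ z * (a z - b z)| ≤
        (A + M.toNNReal * L : ℝ≥0) * dist y z := by
      intro y hy z hz
      have hξd : |ξ y - ξ z| ≤ L * dist y z := by
        rw [← Real.dist_eq]; exact hξ.dist_le_mul y z
      have hML : |(ξ y - ξ z) * (a y - b y)| ≤ M.toNNReal * (L * dist y z) := by
        rw [abs_mul, mul_comm]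
        exact mul_le_mul (hM0 y hy) hξd (abs_nonneg _) (NNReal.coe_nonneg _)
      have hA0 : 0 ≤ (A : ℝ) * dist y z := by positivity
      push_cast
      by_cases hzT : z ∈ tsupport ξ
      · have hAd : |(a y - b y) - (a z - b z)| ≤ A * dist y z := by
          have := hA.dist_le_mul y hy z ⟨hz, hzT⟩
          rw [Real.dist_eq] at this
          rwa [show (a y - b y) - (a z - b z) = (a y + -b y) - (a z + -b z) by ring]
        have h2 : |ξ z * ((a y - b y) - (a z - b z))| ≤ A * dist y z := by
          rw [abs_mul, abs_of_nonneg (h0 z)]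
          exact (mul_le_of_le_one_left (abs_nonneg _) (h1 z)).trans hAd
        calc |ξ y * (a y - b y) - ξ z * (a z - b z)|
            = |(ξ y - ξ z) * (a y - b y) + ξ z * ((a y - b y) - (a z - b z))| := by ring_nf
          _ ≤ _ := (abs_add_le _ _).trans (by linarith)
      · have hz0 : ξ z = 0 := image_eq_zero_of_notMem_tsupport hzT
        rw [hz0, sub_zero] at hML
        rw [hz0, zero_mul, sub_zero]
        linarith
    refine ⟨A + M.toNNReal * L, LipschitzOnWith.of_dist_le_mul fun y hy z hz => ?_⟩
    rw [Real.dist_eq]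
    by_cases hyT : y ∈ tsupport ξ
    · exact key y ⟨hy, hyT⟩ z hz
    · by_cases hzT : z ∈ tsupport ξ
      · rw [abs_sub_comm, dist_comm]
        exact key z ⟨hz, hzT⟩ y hy
      · rw [image_eq_zero_of_notMem_tsupport hyT, image_eq_zero_of_notMem_tsupport hzT]
        simp only [zero_mul, sub_zero, abs_zero]
        positivity
  have := hprod.add hb
  refine fun K hK hKW => ?_
  obtain ⟨M, hM⟩ := this K hK hKW
  refine ⟨M, ?_⟩
  convert hM using 2 with y
  ring


theorem IsWeakUpperGradientOn.mono {g : X → ℝ≥0∞} {u : X → ℝ} {U V : Set X}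
    (h : IsWeakUpperGradientOn μ g u U) (hV : V ⊆ U) : IsWeakUpperGradientOn μ g u V := by
  obtain ⟨Γ, hΓ, hug⟩ := h
  exact ⟨Γ, hΓ, fun γ hγ hin => hug γ hγ fun t ht => hV (hin t ht)⟩

theorem IsWeakUpperGradientOn.comp_lipschitz {g : X → ℝ≥0∞} {u : X → ℝ} {U : Set X}
    (h : IsWeakUpperGradientOn μ g u U) {F : ℝ → ℝ} (hF : LipschitzWith 1 F) :
    IsWeakUpperGradientOn μ g (fun y => F (u y)) U := by
  obtain ⟨Γ, hΓ, hug⟩ := h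
  refine ⟨Γ, hΓ, fun γ hγ hin => le_trans (ENNReal.ofReal_le_ofReal ?_) (hug γ hγ hin)⟩
  have := hF.dist_le_mul (u (γ.toFun 1)) (u (γ.toFun 0))
  simpa [Real.dist_eq] using this

theorem IsWeakUpperGradientOn.add {g g' : X → ℝ≥0∞} {u v : X → ℝ} {U : Set X}
    (hu : IsWeakUpperGradientOn μ g u U) (hv : IsWeakUpperGradientOn μ g' v U) :
    IsWeakUpperGradientOn μ (fun y => g y + g' y) (fun y => u y + v y) U := by
  obtain ⟨Γ, hΓ, hug⟩ := hu
  obtain ⟨Γ', hΓ', hvg⟩ := hv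
  refine ⟨Γ ∪ Γ', Mod1_union_eq_zero hΓ hΓ', fun γ hγ hin => ?_⟩
  rw [mem_union, not_or] at hγ
  refine le_trans ?_ ((add_le_add (hug γ hγ.1 hin) (hvg γ hγ.2 hin)).trans
    ((le_lintegral_add _ _).trans_eq ?_))
  · rw [← ENNReal.ofReal_add (abs_nonneg _) (abs_nonneg _)]
    refine ENNReal.ofReal_le_ofReal ?_
    rw [add_sub_add_comm]
    exact abs_add_le _ _
  · simp only [curveIntegral, add_mul]

/-- The positive part of `u - k` only varies where `u > k`. -/
theorem IsWeakUpperGradientOn.posPart {g : X → ℝ≥0∞} {u : X → ℝ} {U : Set X} (hU : IsOpen U)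
    (hu : ContinuousOn u U) (h : IsWeakUpperGradientOn μ g u U) (k : ℝ) :
    IsWeakUpperGradientOn μ ({y | y ∈ U ∧ k < u y}.indicator g) (fun y => max (u y - k) 0) U := by
  obtain ⟨Γ, hΓ, hug⟩ := h.exists_along
  refine ⟨Γ, hΓ, fun γ hγ hin => ?_⟩
  have hlip : ∀ c a b : ℝ, |max (a - c) 0 - max (b - c) 0| ≤ |a - b| := fun c a b => by
    simpa using abs_max_sub_max_le_abs (a - c) (b - c) 0
  have key : ∀ ε : ℝ, 0 < ε → ENNReal.ofReal
      |max (u (γ.toFun 1) - (k + ε)) 0 - max (u (γ.toFun 0) - (k + ε)) 0| ≤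
      curveIntegral ({y | y ∈ U ∧ k < u y}.indicator g) γ := by
    intro ε hε
    refine ofReal_abs_sub_le_lintegral_of_local
      (h := fun τ => max (u (γ.toFun τ) - (k + ε)) 0) fun t₀ ht₀ => ?_
    rcases lt_or_ge k (u (γ.toFun t₀)) with hk | hk
    · obtain ⟨N, hN, hN'⟩ := γ.exists_nhds_forall_abs_sub_lt hU hu ht₀ (hin _ ht₀) (sub_pos.2 hk)
      refine ⟨N, hN, fun s t hs hst ht hsub => ?_⟩
      have hmem : ∀ τ ∈ Icc s t, τ ∈ N ∩ Icc (0 : ℝ) 1 := fun τ hτ =>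
        ⟨hsub hτ, hs.trans hτ.1, hτ.2.trans ht⟩
      refine (ENNReal.ofReal_le_ofReal (hlip _ _ _)).trans
        ((hug γ hγ s t hs hst ht fun τ hτ => (hN' τ (hmem τ hτ)).1).trans ?_)
      refine setLIntegral_mono' measurableSet_Ioo fun τ hτ => ?_
      have hτ' := hN' τ (hmem τ (Ioo_subset_Icc_self hτ))
      rw [indicator_of_mem]
      exact ⟨hτ'.1, by linarith [(abs_lt.1 hτ'.2).1]⟩
    · obtain ⟨N, hN, hN'⟩ := γ.exists_nhds_forall_abs_sub_lt hU hu ht₀ (hin _ ht₀) hε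
      refine ⟨N, hN, fun s t hs hst ht hsub => ?_⟩
      have hz : ∀ τ ∈ Icc s t, max (u (γ.toFun τ) - (k + ε)) 0 = 0 := fun τ hτ => by
        have := (hN' τ ⟨hsub hτ, hs.trans hτ.1, hτ.2.trans ht⟩).2
        exact max_eq_right (by linarith [(abs_lt.1 this).2])
      simp only [hz t ⟨hst, le_rfl⟩, hz s ⟨le_rfl, hst⟩, sub_self, abs_zero, ENNReal.ofReal_zero]
      exact zero_le
  refine ENNReal.le_of_forall_pos_le_add fun ε hε _ => ?_
  have hε' : (0 : ℝ) < ε / 2 := by positivity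
  have hpt : ∀ a : ℝ, |max (a - k) 0 - max (a - (k + ε / 2)) 0| ≤ (ε : ℝ) / 2 := fun a => by
    have := abs_max_sub_max_le_abs (a - k) (a - (k + ε / 2)) 0
    rwa [show a - k - (a - (k + (ε : ℝ) / 2)) = ε / 2 by ring, abs_of_pos hε'] at this
  calc ENNReal.ofReal |max (u (γ.toFun 1) - k) 0 - max (u (γ.toFun 0) - k) 0|
      ≤ ENNReal.ofReal (|max (u (γ.toFun 1) - (k + ε / 2)) 0 -
          max (u (γ.toFun 0) - (k + ε / 2)) 0| + ε) := by
        refine ENNReal.ofReal_le_ofReal ?_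
        have e1 := abs_le.1 (hpt (u (γ.toFun 1)))
        have e0 := abs_le.1 (hpt (u (γ.toFun 0)))
        have e2 := abs_le.1 (le_refl |max (u (γ.toFun 1) - (k + ε / 2)) 0 -
          max (u (γ.toFun 0) - (k + ε / 2)) 0|)
        rw [abs_le]
        constructor <;> linarith
    _ ≤ _ := by
        rw [ENNReal.ofReal_add (abs_nonneg _) (NNReal.coe_nonneg ε)]
        exact add_le_add (key _ hε') (by simp)

/-- The Leibniz rule: a weak upper gradient for the interpolation `ξ a + (1 - ξ) b`. -/
theorem IsWeakUpperGradientOn.interpolate {ξ a b : X → ℝ} {L : ℝ≥0} (hξ : LipschitzWith L ξ)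
    (h0 : ∀ y, 0 ≤ ξ y) (h1 : ∀ y, ξ y ≤ 1) {U V W : Set X} (hV : IsOpen V)
    (hTV : tsupport ξ ⊆ V) (hVU : V ⊆ U) (hVW : V ⊆ W) (ha : ContinuousOn a U)
    (hb : ContinuousOn b W) {ga gb : X → ℝ≥0∞} (hga : IsWeakUpperGradientOn μ ga a U)
    (hgb : IsWeakUpperGradientOn μ gb b W) {ω : ℝ} (hω : 0 < ω) :
    IsWeakUpperGradientOn μ
      (fun y => V.indicator (fun y => ENNReal.ofReal (ξ y + ω) * ga y +
        L * ENNReal.ofReal (|a y - b y| + ω)) y + ENNReal.ofReal (1 - ξ y + ω) * gb y)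
      (fun y => ξ y * a y + (1 - ξ y) * b y) W := by
  obtain ⟨Γa, hΓa, hug⟩ := hga.exists_along
  obtain ⟨Γb, hΓb, hvg⟩ := hgb.exists_along
  refine ⟨Γa ∪ Γb, Mod1_union_eq_zero hΓa hΓb, fun γ hγ hin => ?_⟩
  rw [mem_union, not_or] at hγ
  refine ofReal_abs_sub_le_lintegral_of_local
    (h := fun τ => ξ (γ.toFun τ) * a (γ.toFun τ) + (1 - ξ (γ.toFun τ)) * b (γ.toFun τ))
    fun t₀ ht₀ => ?_
  have hbs : ∀ s t, 0 ≤ s → s ≤ t → t ≤ 1 → ENNReal.ofReal |b (γ.toFun t) - b (γ.toFun s)| ≤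
      ∫⁻ τ in Ioo s t, gb (γ.toFun τ) * speed γ.toFun τ := fun s t hs hst ht =>
    hvg γ hγ.2 s t hs hst ht fun τ hτ => hin _ ⟨hs.trans hτ.1, hτ.2.trans ht⟩
  by_cases hγV : γ.toFun t₀ ∈ V
  · have hd : ContinuousOn (fun y => |a y - b y|) V := ((ha.mono hVU).sub (hb.mono hVW)).abs
    obtain ⟨N, hN, hN'⟩ := γ.exists_nhds_forall_abs_sub_lt hV hd ht₀ hγV (half_pos hω)
    obtain ⟨M, hM, hM'⟩ := γ.exists_nhds_forall_abs_sub_lt hV hξ.continuous.continuousOn ht₀ hγV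
      (half_pos hω)
    refine ⟨N ∩ M, inter_mem hN hM, fun s t hs hst ht hsub => ?_⟩
    have hmem : ∀ τ ∈ Icc s t, τ ∈ Icc (0 : ℝ) 1 := fun τ hτ => ⟨hs.trans hτ.1, hτ.2.trans ht⟩
    have hN2 := fun τ (hτ : τ ∈ Icc s t) => hN' τ ⟨(hsub hτ).1, hmem τ hτ⟩
    have hM2 := fun τ (hτ : τ ∈ Icc s t) => hM' τ ⟨(hsub hτ).2, hmem τ hτ⟩
    have has := hug γ hγ.1 s t hs hst ht fun τ hτ => hVU (hN2 τ hτ).1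
    have hσ := ofReal_dist_le_lintegral_speed γ hs hst ht
    have hξd : ENNReal.ofReal |ξ (γ.toFun t) - ξ (γ.toFun s)| ≤
        L * ∫⁻ τ in Ioo s t, speed γ.toFun τ := by
      refine le_trans ?_ (mul_le_mul_right hσ _)
      rw [← ENNReal.ofReal_coe_nnreal, ← ENNReal.ofReal_mul (NNReal.coe_nonneg _)]
      refine ENNReal.ofReal_le_ofReal ?_
      rw [← Real.dist_eq]
      exact hξ.dist_le_mul _ _
    have ht' : t ∈ Icc s t := ⟨hst, le_rfl⟩
    have hs' : s ∈ Icc s t := ⟨le_rfl, hst⟩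
    set x := γ.toFun t
    set y := γ.toFun s
    calc ENNReal.ofReal |ξ x * a x + (1 - ξ x) * b x - (ξ y * a y + (1 - ξ y) * b y)|
        ≤ ENNReal.ofReal (ξ x * |a x - a y| + |a y - b y| * |ξ x - ξ y| +
            (1 - ξ x) * |b x - b y|) := by
          refine ENNReal.ofReal_le_ofReal ?_
          rw [show ξ x * a x + (1 - ξ x) * b x - (ξ y * a y + (1 - ξ y) * b y) =
            ξ x * (a x - a y) + (a y - b y) * (ξ x - ξ y) + (1 - ξ x) * (b x - b y) by ring]
          refine (abs_add_three _ _ _).trans ?_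
          rw [abs_mul, abs_mul, abs_mul, abs_of_nonneg (h0 x),
            abs_of_nonneg (sub_nonneg.2 (h1 x))]
      _ = ENNReal.ofReal (ξ x) * ENNReal.ofReal |a x - a y| +
            ENNReal.ofReal |a y - b y| * ENNReal.ofReal |ξ x - ξ y| +
            ENNReal.ofReal (1 - ξ x) * ENNReal.ofReal |b x - b y| := by
          have i1 := mul_nonneg (h0 x) (abs_nonneg (a x - a y))
          have i2 := mul_nonneg (abs_nonneg (a y - b y)) (abs_nonneg (ξ x - ξ y))
          have i3 := mul_nonneg (sub_nonneg.2 (h1 x)) (abs_nonneg (b x - b y))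
          rw [ENNReal.ofReal_add (add_nonneg i1 i2) i3, ENNReal.ofReal_add i1 i2,
            ENNReal.ofReal_mul (h0 x), ENNReal.ofReal_mul (abs_nonneg _),
            ENNReal.ofReal_mul (sub_nonneg.2 (h1 x))]
      _ ≤ ENNReal.ofReal (ξ x) * (∫⁻ τ in Ioo s t, ga (γ.toFun τ) * speed γ.toFun τ) +
            ENNReal.ofReal |a y - b y| * (L * ∫⁻ τ in Ioo s t, speed γ.toFun τ) +
            ENNReal.ofReal (1 - ξ x) * (∫⁻ τ in Ioo s t, gb (γ.toFun τ) * speed γ.toFun τ) := by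
          gcongr
          exact hbs s t hs hst ht
      _ ≤ ∫⁻ τ in Ioo s t, (ENNReal.ofReal (ξ x) * (ga (γ.toFun τ) * speed γ.toFun τ) +
            ENNReal.ofReal |a y - b y| * L * speed γ.toFun τ +
            ENNReal.ofReal (1 - ξ x) * (gb (γ.toFun τ) * speed γ.toFun τ)) := by
          refine le_trans ?_ (le_lintegral_add _ _)
          refine add_le_add (le_trans (add_le_add ?_ ?_) (le_lintegral_add _ _)) ?_
          · exact lintegral_const_mul_le _ _
          · rw [← mul_assoc]; exact lintegral_const_mul_le _ _
          · exact lintegral_const_mul_le _ _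
      _ ≤ _ := by
          refine setLIntegral_mono' measurableSet_Ioo fun τ hτ => ?_
          have hτ' := Ioo_subset_Icc_self hτ
          have b1 := abs_lt.1 (hM2 τ hτ').2
          have b2 := abs_lt.1 (hM2 t ht').2
          have b3 := abs_lt.1 (hN2 τ hτ').2
          have b4 := abs_lt.1 (hN2 s hs').2
          beta_reduce
          rw [indicator_of_mem (hN2 τ hτ').1, add_mul, add_mul, ← mul_assoc, ← mul_assoc,
            mul_comm (ENNReal.ofReal |a y - b y|)]
          gcongr
          · linarith
          · linarith
          · linarith
  · have hγT : γ.toFun t₀ ∈ (tsupport ξ)ᶜ := fun hc => hγV (hTV hc)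
    obtain ⟨N, hN, hN'⟩ := γ.exists_nhds_forall_abs_sub_lt (isClosed_tsupport ξ).isOpen_compl
      (u := ξ) hξ.continuous.continuousOn ht₀ hγT one_pos
    refine ⟨N, hN, fun s t hs hst ht hsub => ?_⟩
    have hz : ∀ τ ∈ Icc s t, ξ (γ.toFun τ) = 0 := fun τ hτ =>
      image_eq_zero_of_notMem_tsupport (hN' τ ⟨hsub hτ, hs.trans hτ.1, hτ.2.trans ht⟩).1
    simp only [hz t ⟨hst, le_rfl⟩, hz s ⟨le_rfl, hst⟩, zero_mul, zero_add, sub_zero, one_mul]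
    refine (hbs s t hs hst ht).trans (setLIntegral_mono' measurableSet_Ioo fun τ hτ => ?_)
    rw [hz τ (Ioo_subset_Icc_self hτ), add_mul, sub_zero]
    refine le_add_left ?_
    rw [mul_assoc]
    refine le_mul_of_one_le_left' ?_
    rw [ENNReal.one_le_ofReal]
    linarith

/-! ### The total variation -/


theorem TendstoL1Loc.comp_lipschitz {v : ℕ → X → ℝ} {u : X → ℝ} {U : Set X}
    (h : TendstoL1Loc μ v u U) {F : ℝ → ℝ} (hF : LipschitzWith 1 F) :
    TendstoL1Loc μ (fun i y => F (v i y)) (fun y => F (u y)) U := by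
  intro K hK hKU
  refine tendsto_of_tendsto_of_tendsto_of_le_of_le tendsto_const_nhds (h K hK hKU)
    (fun i => zero_le) fun i => lintegral_mono fun y => ENNReal.ofReal_le_ofReal ?_
  have := hF.dist_le_mul (v i y) (u y)
  simpa [Real.dist_eq] using this

theorem TendstoL1Loc.mono {v : ℕ → X → ℝ} {u : X → ℝ} {U V : Set X}
    (h : TendstoL1Loc μ v u U) (hV : V ⊆ U) : TendstoL1Loc μ v u V :=
  fun K hK hKV => h K hK (hKV.trans hV)

theorem TendstoL1Loc.comp_strictMono {v : ℕ → X → ℝ} {u : X → ℝ} {U : Set X}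
    (h : TendstoL1Loc μ v u U) {φ : ℕ → ℕ} (hφ : StrictMono φ) :
    TendstoL1Loc μ (fun i => v (φ i)) u U :=
  fun K hK hKU => (h K hK hKU).comp hφ.tendsto_atTop

theorem tv_le_liminf {u : X → ℝ} {U : Set X} {v : ℕ → X → ℝ} {g : ℕ → X → ℝ≥0∞}
    (hv : ∀ i, LocLipschitzOn (v i) U) (hvu : TendstoL1Loc μ v u U) (hgm : ∀ i, Measurable (g i))
    (hg : ∀ i, IsWeakUpperGradientOn μ (g i) (v i) U) :
    tv μ u U ≤ liminf (fun i => ∫⁻ x in U, g i x ∂μ) atTop :=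
  iInf_le_of_le v <| iInf_le_of_le hv <| iInf_le_of_le hvu <| iInf_le_of_le g <|
    iInf_le_of_le hgm <| iInf_le_of_le hg le_rfl

theorem exists_seq_of_tv_lt {u : X → ℝ} {U : Set X} {c : ℝ≥0∞} (h : tv μ u U < c) :
    ∃ (v : ℕ → X → ℝ) (g : ℕ → X → ℝ≥0∞), (∀ i, LocLipschitzOn (v i) U) ∧
      TendstoL1Loc μ v u U ∧ (∀ i, Measurable (g i)) ∧
      (∀ i, IsWeakUpperGradientOn μ (g i) (v i) U) ∧ ∀ i, ∫⁻ x in U, g i x ∂μ < c := by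
  simp only [tv, iInf_lt_iff] at h
  obtain ⟨v, hv, hvu, g, hgm, hg, hlt⟩ := h
  obtain ⟨φ, hφ, hφ'⟩ := extraction_of_frequently_atTop (frequently_lt_of_liminf_lt (h := hlt))
  exact ⟨fun i => v (φ i), fun i => g (φ i), fun i => hv _, hvu.comp_strictMono hφ,
    fun i => hgm _, fun i => hg _, hφ'⟩

theorem tv_le_of_seq {u : X → ℝ} {U : Set X} {c : ℝ≥0∞} {v : ℕ → X → ℝ} {g : ℕ → X → ℝ≥0∞}
    (hv : ∀ i, LocLipschitzOn (v i) U) (hvu : TendstoL1Loc μ v u U) (hgm : ∀ i, Measurable (g i))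
    (hg : ∀ i, IsWeakUpperGradientOn μ (g i) (v i) U) (hc : ∀ i, ∫⁻ x in U, g i x ∂μ ≤ c) :
    tv μ u U ≤ c :=
  (tv_le_liminf hv hvu hgm hg).trans
    (liminf_le_of_frequently_le' (Eventually.of_forall hc).frequently)

theorem tv_mono {u : X → ℝ} {U V : Set X} (hV : V ⊆ U) : tv μ u V ≤ tv μ u U := by
  refine le_of_forall_gt_imp_ge_of_dense fun c hc => ?_
  obtain ⟨v, g, hv, hvu, hgm, hg, hlt⟩ := exists_seq_of_tv_lt hc
  exact tv_le_of_seq (fun i => (hv i).mono hV) (hvu.mono hV) hgm (fun i => (hg i).mono hV)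
    fun i => (lintegral_mono_set hV).trans (hlt i).le

theorem tv_comp_lipschitz_le {u : X → ℝ} {U : Set X} {F : ℝ → ℝ} (hF : LipschitzWith 1 F) :
    tv μ (fun y => F (u y)) U ≤ tv μ u U := by
  refine le_of_forall_gt_imp_ge_of_dense fun c hc => ?_
  obtain ⟨v, g, hv, hvu, hgm, hg, hlt⟩ := exists_seq_of_tv_lt hc
  exact tv_le_of_seq (fun i => (hv i).comp_lipschitz hF) (hvu.comp_lipschitz hF) hgm
    (fun i => (hg i).comp_lipschitz hF) fun i => (hlt i).le

theorem tv_const (c : ℝ) (U : Set X) : tv μ (fun _ => c) U = 0 := by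
  refine le_antisymm (tv_le_of_seq (v := fun _ _ => c) (g := fun _ _ => 0) (fun i K _ _ =>
    ⟨0, (LipschitzWith.const c).lipschitzOnWith⟩) (fun K _ _ => by simp)
    (fun i => measurable_const) (fun i => ⟨∅, ?_, fun γ _ _ => by simp⟩) (by simp)) zero_le
  exact le_antisymm (iInf_le_of_le 0 (iInf_le_of_le measurable_zero
    (iInf_le_of_le (by simp) (by simp)))) zero_le

theorem tv_le_of_ae_eq [BorelSpace X] {u u' : X → ℝ} {U : Set X}
    (h : ∀ᵐ y ∂μ, y ∈ U → u y = u' y) : tv μ u U ≤ tv μ u' U := by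
  refine le_of_forall_gt_imp_ge_of_dense fun c hc => ?_
  obtain ⟨v, g, hv, hvu, hgm, hg, hlt⟩ := exists_seq_of_tv_lt hc
  refine tv_le_of_seq hv (fun K hK hKU => ?_) hgm hg fun i => (hlt i).le
  refine (hvu K hK hKU).congr fun i => ?_
  refine setLIntegral_congr_fun_ae hK.measurableSet ?_
  filter_upwards [h] with y hy hyK
  rw [hy (hKU hyK)]

theorem aemeasurable_ofReal_abs_sub {ν : Measure X} {p q : X → ℝ} (hp : AEMeasurable p ν)
    (hq : AEMeasurable q ν) : AEMeasurable (fun y => ENNReal.ofReal |p y - q y|) ν :=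
  ENNReal.measurable_ofReal.comp_aemeasurable
    (measurable_norm.comp_aemeasurable (hp.sub hq))

theorem ofReal_abs_le_add {a b c : ℝ} (h : |a| ≤ |b| + |c|) :
    ENNReal.ofReal |a| ≤ ENNReal.ofReal |b| + ENNReal.ofReal |c| := by
  rw [← ENNReal.ofReal_add (abs_nonneg _) (abs_nonneg _)]
  exact ENNReal.ofReal_le_ofReal h

theorem tv_add_le [BorelSpace X] {p q : X → ℝ} {U : Set X}
    (hp : ∀ K, IsCompact K → K ⊆ U → AEMeasurable p (μ.restrict K)) :
    tv μ (fun y => p y + q y) U ≤ tv μ p U + tv μ q U := by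
  refine ENNReal.le_of_forall_pos_le_add fun ε hε hfin => ?_
  have hε2 : (ε / 2 : ℝ≥0∞) ≠ 0 := by simpa using hε.ne'
  obtain ⟨hpf, hqf⟩ := ENNReal.add_lt_top.1 hfin
  obtain ⟨v, g, hv, hvu, hgm, hg, hlt⟩ :=
    exists_seq_of_tv_lt (ENNReal.lt_add_right hpf.ne hε2)
  obtain ⟨v', g', hv', hvu', hgm', hg', hlt'⟩ :=
    exists_seq_of_tv_lt (ENNReal.lt_add_right hqf.ne hε2)
  rw [show tv μ p U + tv μ q U + ε = tv μ p U + ε / 2 + (tv μ q U + ε / 2) by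
    rw [add_add_add_comm, ENNReal.add_halves]]
  refine tv_le_of_seq (fun i => (hv i).add (hv' i)) (fun K hK hKU => ?_)
    (fun i => (hgm i).add (hgm' i)) (fun i => (hg i).add (hg' i)) fun i => ?_
  · have h0 := (hvu K hK hKU).add (hvu' K hK hKU)
    rw [add_zero] at h0
    refine tendsto_of_tendsto_of_tendsto_of_le_of_le tendsto_const_nhds h0 (fun i => zero_le)
      fun i => ?_
    have hm : AEMeasurable (v i) (μ.restrict K) :=
      ((hv i).continuousOn.mono hKU).aemeasurable hK.measurableSet
    beta_reduce
    rw [← lintegral_add_left' (aemeasurable_ofReal_abs_sub hm (hp K hK hKU))]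
    refine lintegral_mono fun y => ofReal_abs_le_add ?_
    rw [add_sub_add_comm]
    exact abs_add_le _ _
  · simp only [Pi.add_apply]
    rw [lintegral_add_left (hgm i)]
    exact add_le_add (hlt i).le (hlt' i).le

theorem lipschitzWith_posPart (k : ℝ) : LipschitzWith 1 fun t : ℝ => max (t - k) 0 :=
  LipschitzWith.of_dist_le_mul fun a b => by
    simpa [Real.dist_eq] using abs_max_sub_max_le_abs (a - k) (b - k) 0

theorem lipschitzWith_min_const (k : ℝ) : LipschitzWith 1 fun t : ℝ => min t k :=
  LipschitzWith.id.min_const k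

theorem liminf_add_liminf_le (a b : ℕ → ℝ≥0∞) :
    liminf a atTop + liminf b atTop ≤ liminf (fun i => a i + b i) atTop := by
  simp only [liminf_eq_iSup_iInf_of_nat]
  rw [ENNReal.iSup_add_iSup_of_monotone]
  · exact iSup_mono fun n => le_iInf₂ fun i hi => add_le_add (iInf₂_le i hi) (iInf₂_le i hi)
  · exact fun m n h => le_iInf₂ fun i hi => iInf₂_le i (h.trans hi)
  · exact fun m n h => le_iInf₂ fun i hi => iInf₂_le i (h.trans hi)

set_option maxHeartbeats 1000000 in
/-- Truncating a function at height `k` splits its total variation. -/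
theorem tv_min_add_tv_posPart_le [BorelSpace X] {u : X → ℝ} {U : Set X} (hU : IsOpen U) (k : ℝ) :
    tv μ (fun y => min (u y) k) U + tv μ (fun y => max (u y - k) 0) U ≤ tv μ u U := by
  refine le_of_forall_gt_imp_ge_of_dense fun c hc => ?_
  obtain ⟨v, g, hv, hvu, hgm, hg, hlt⟩ := exists_seq_of_tv_lt hc
  have hneg : LipschitzWith 1 fun t : ℝ => -t := LipschitzWith.id.neg
  have hrefl : LipschitzWith 1 fun t : ℝ => k - t :=
    LipschitzWith.of_dist_le_mul fun a b => by
      rw [Real.dist_eq, Real.dist_eq, show k - a - (k - b) = b - a by ring, abs_sub_comm]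
      simp
  have hcont := fun i => (hv i).continuousOn
  obtain ⟨A, hAdef⟩ : ∃ A : ℕ → Set X, ∀ i, A i = {y | y ∈ U ∧ k < v i y} := ⟨_, fun _ => rfl⟩
  obtain ⟨B, hBdef⟩ : ∃ B : ℕ → Set X, ∀ i, B i = {y | y ∈ U ∧ -k < -v i y} := ⟨_, fun _ => rfl⟩
  have hA : ∀ i, MeasurableSet (A i) := fun i => by
    rw [hAdef]
    exact ((hcont i).isOpen_inter_preimage hU isOpen_Ioi).measurableSet
  have hB : ∀ i, MeasurableSet (B i) := fun i => by
    rw [hBdef]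
    exact ((hcont i).neg.isOpen_inter_preimage hU isOpen_Ioi).measurableSet
  have hgA : ∀ i, IsWeakUpperGradientOn μ ((A i).indicator (g i))
      (fun y => max (v i y - k) 0) U := fun i => by
    rw [hAdef]
    exact (hg i).posPart hU (hcont i) k
  have hgB : ∀ i, IsWeakUpperGradientOn μ ((B i).indicator (g i))
      (fun y => min (v i y) k) U := fun i => by
    have hn : IsWeakUpperGradientOn μ (g i) (fun y => -v i y) U := (hg i).comp_lipschitz hneg
    have hm := (hn.posPart hU (hcont i).neg (-k)).comp_lipschitz hrefl
    have he : (fun y => min (v i y) k) = fun y => k - max (-v i y - -k) 0 := by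
      ext y
      rcases le_total (v i y) k with h | h
      · rw [min_eq_left h, max_eq_left (by linarith)]; ring
      · rw [min_eq_right h, max_eq_right (by linarith)]; ring
    rw [he, hBdef]
    exact hm
  have h1 : tv μ (fun y => max (u y - k) 0) U ≤
      liminf (fun i => ∫⁻ y in U, (A i).indicator (g i) y ∂μ) atTop :=
    tv_le_liminf (v := fun i y => max (v i y - k) 0)
      (fun i => (hv i).comp_lipschitz (lipschitzWith_posPart k))
      (hvu.comp_lipschitz (lipschitzWith_posPart k)) (fun i => (hgm i).indicator (hA i)) hgA
  have h2 : tv μ (fun y => min (u y) k) U ≤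
      liminf (fun i => ∫⁻ y in U, (B i).indicator (g i) y ∂μ) atTop :=
    tv_le_liminf (v := fun i y => min (v i y) k)
      (fun i => (hv i).comp_lipschitz (lipschitzWith_min_const k))
      (hvu.comp_lipschitz (lipschitzWith_min_const k)) (fun i => (hgm i).indicator (hB i)) hgB
  refine (add_le_add h2 h1).trans ((liminf_add_liminf_le _ _).trans ?_)
  refine liminf_le_of_frequently_le' (Eventually.of_forall fun i => ?_).frequently
  refine le_trans ?_ (hlt i).le
  rw [← lintegral_add_left ((hgm i).indicator (hB i))]
  refine lintegral_mono fun y => ?_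
  by_cases hy : y ∈ A i
  · have : y ∉ B i := fun h => by
      rw [hBdef] at h
      rw [hAdef] at hy
      have h1 := h.2
      have h2 := hy.2
      linarith
    rw [indicator_of_mem hy, indicator_of_notMem this, zero_add]
  · rw [indicator_of_notMem hy, add_zero]
    exact indicator_le_self _ _ _

theorem TendstoL1Loc.interpolate [BorelSpace X] {ξ a b : X → ℝ} {as bs : ℕ → X → ℝ} {U W : Set X}
    (h0 : ∀ y, 0 ≤ ξ y) (h1 : ∀ y, ξ y ≤ 1) (hT : IsCompact (tsupport ξ)) (hTU : tsupport ξ ⊆ U)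
    (has : ∀ i, ContinuousOn (as i) U) (ha : AEMeasurable a (μ.restrict (tsupport ξ)))
    (hasa : TendstoL1Loc μ as a U) (hbsb : TendstoL1Loc μ bs b W) :
    TendstoL1Loc μ (fun i y => ξ y * as i y + (1 - ξ y) * bs i y)
      (fun y => ξ y * a y + (1 - ξ y) * b y) W := by
  intro K hK hKW
  have hlim := (hasa _ hT hTU).add (hbsb K hK hKW)
  rw [add_zero] at hlim
  refine tendsto_of_tendsto_of_tendsto_of_le_of_le tendsto_const_nhds hlim (fun i => zero_le)
    fun i => ?_
  have hm : AEMeasurable (fun y => ENNReal.ofReal |as i y - a y|) (μ.restrict (tsupport ξ)) :=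
    aemeasurable_ofReal_abs_sub (((has i).mono hTU).aemeasurable hT.measurableSet) ha
  have hm' : AEMeasurable ((tsupport ξ).indicator fun y => ENNReal.ofReal |as i y - a y|) μ :=
    (aemeasurable_indicator_iff hT.measurableSet).2 hm
  calc ∫⁻ y in K, ENNReal.ofReal |ξ y * as i y + (1 - ξ y) * bs i y
        - (ξ y * a y + (1 - ξ y) * b y)| ∂μ
      ≤ ∫⁻ y in K, (tsupport ξ).indicator (fun y => ENNReal.ofReal |as i y - a y|) y
          + ENNReal.ofReal |bs i y - b y| ∂μ := by
        refine lintegral_mono fun y => ?_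
        by_cases hy : y ∈ tsupport ξ
        · rw [indicator_of_mem hy]
          refine ofReal_abs_le_add ?_
          have e : ξ y * as i y + (1 - ξ y) * bs i y - (ξ y * a y + (1 - ξ y) * b y)
            = ξ y * (as i y - a y) + (1 - ξ y) * (bs i y - b y) := by ring
          rw [e]
          refine (abs_add_le _ _).trans ?_
          rw [abs_mul, abs_mul, abs_of_nonneg (h0 y), abs_of_nonneg (sub_nonneg.2 (h1 y))]
          have := abs_nonneg (as i y - a y)
          have := abs_nonneg (bs i y - b y)
          nlinarith [h0 y, h1 y]
        · rw [indicator_of_notMem hy, zero_add, image_eq_zero_of_notMem_tsupport hy]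
          simp
    _ = ∫⁻ y in K, (tsupport ξ).indicator (fun y => ENNReal.ofReal |as i y - a y|) y ∂μ
          + ∫⁻ y in K, ENNReal.ofReal |bs i y - b y| ∂μ := lintegral_add_left' hm'.restrict _
    _ ≤ _ := by
        refine add_le_add ?_ le_rfl
        refine (setLIntegral_le_lintegral _ _).trans ?_
        rw [lintegral_indicator hT.measurableSet]

theorem measurable_indicator_of_continuousOn [BorelSpace X] {V : Set X} (hV : IsOpen V)
    {h : X → ℝ≥0∞} (hh : ContinuousOn h V) : Measurable (V.indicator h) := by
  classical
  rw [← piecewise_eq_indicator]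
  exact hh.measurable_piecewise continuousOn_const hV.measurableSet

theorem lintegral_abs_sub_add_le [BorelSpace X] {a b a' b' : X → ℝ} {V : Set X} (hV : IsOpen V)
    (ha : AEMeasurable a (μ.restrict V)) (hb : AEMeasurable b (μ.restrict V))
    (ha' : ContinuousOn a' V) (hb' : ContinuousOn b' V) {ω : ℝ} (hω : 0 < ω) :
    ∫⁻ y in V, ENNReal.ofReal (|a' y - b' y| + ω) ∂μ ≤
      ∫⁻ y in closure V, ENNReal.ofReal |a' y - a y| ∂μ +
      (∫⁻ y in closure V, ENNReal.ofReal |b' y - b y| ∂μ +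
      (∫⁻ y in V, ENNReal.ofReal |a y - b y| ∂μ + ENNReal.ofReal ω * μ V)) := by
  have hma := aemeasurable_ofReal_abs_sub (ha'.aemeasurable hV.measurableSet) ha
  have hmb := aemeasurable_ofReal_abs_sub (hb'.aemeasurable hV.measurableSet) hb
  calc ∫⁻ y in V, ENNReal.ofReal (|a' y - b' y| + ω) ∂μ
      ≤ ∫⁻ y in V, (ENNReal.ofReal |a' y - a y| + (ENNReal.ofReal |b' y - b y| +
          (ENNReal.ofReal |a y - b y| + ENNReal.ofReal ω))) ∂μ := by
        refine lintegral_mono fun y => ?_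
        have h3 := abs_add_three (a' y - a y) (b y - b' y) (a y - b y)
        rw [← ENNReal.ofReal_add (by positivity) (by positivity),
          ← ENNReal.ofReal_add (by positivity) (by positivity),
          ← ENNReal.ofReal_add (by positivity) (by positivity)]
        refine ENNReal.ofReal_le_ofReal ?_
        rw [abs_sub_comm (b' y)]
        rw [show a' y - a y + (b y - b' y) + (a y - b y) = a' y - b' y by ring] at h3
        linarith
    _ = ∫⁻ y in V, ENNReal.ofReal |a' y - a y| ∂μ +
          (∫⁻ y in V, ENNReal.ofReal |b' y - b y| ∂μ +
          (∫⁻ y in V, ENNReal.ofReal |a y - b y| ∂μ + ENNReal.ofReal ω * μ V)) := by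
        rw [lintegral_add_left' hma, lintegral_add_left' hmb,
          lintegral_add_right _ measurable_const, setLIntegral_const]
    _ ≤ _ := by
        gcongr <;> exact subset_closure

theorem lintegral_interpolate_energy_le [BorelSpace X] {ξ a b : X → ℝ} {L : ℝ≥0}
    (hξ : Continuous ξ) (h0 : ∀ y, 0 ≤ ξ y) (h1 : ∀ y, ξ y ≤ 1) {U V W B : Set X}
    (hV : IsOpen V) (hB : MeasurableSet B) (hVU : V ⊆ U) (hBW : B ⊆ W)
    (hξB : ∀ y ∈ B, ξ y = 1) {ga gb : X → ℝ≥0∞} (hga : Measurable ga) (hgb : Measurable gb)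
    {ω : ℝ} (hω : 0 < ω) :
    ∫⁻ y in W, (V.indicator (fun y => ENNReal.ofReal (ξ y + ω) * ga y +
        L * ENNReal.ofReal (|a y - b y| + ω)) y + ENNReal.ofReal (1 - ξ y + ω) * gb y) ∂μ +
      ∫⁻ y in B, gb y ∂μ ≤
    ENNReal.ofReal (1 + ω) * (∫⁻ y in U, ga y ∂μ + ∫⁻ y in W, gb y ∂μ) +
      L * ∫⁻ y in V, ENNReal.ofReal (|a y - b y| + ω) ∂μ := by
  have hm1 : Measurable fun y => ENNReal.ofReal (1 - ξ y + ω) * gb y :=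
    (((continuous_const.sub hξ).add continuous_const).measurable.ennreal_ofReal).mul hgb
  have hm2 : Measurable fun y => ENNReal.ofReal (ξ y + ω) * ga y :=
    ((hξ.add continuous_const).measurable.ennreal_ofReal).mul hga
  have e1 : ∫⁻ y in W, V.indicator (fun y => ENNReal.ofReal (ξ y + ω) * ga y +
        L * ENNReal.ofReal (|a y - b y| + ω)) y ∂μ ≤
      ENNReal.ofReal (1 + ω) * ∫⁻ y in U, ga y ∂μ +
        L * ∫⁻ y in V, ENNReal.ofReal (|a y - b y| + ω) ∂μ := by
    refine (setLIntegral_le_lintegral _ _).trans ?_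
    rw [lintegral_indicator hV.measurableSet, lintegral_add_left hm2,
      lintegral_const_mul' _ _ ENNReal.coe_ne_top]
    gcongr
    rw [← lintegral_const_mul _ hga]
    refine (lintegral_mono_set hVU).trans (lintegral_mono fun y => ?_)
    gcongr
    exact h1 y
  have e2 : ∫⁻ y in W, ENNReal.ofReal (1 - ξ y + ω) * gb y ∂μ + ∫⁻ y in B, gb y ∂μ ≤
      ENNReal.ofReal (1 + ω) * ∫⁻ y in W, gb y ∂μ := by
    have hBi : ∫⁻ y in B, gb y ∂μ = ∫⁻ y in W, B.indicator gb y ∂μ := by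
      rw [lintegral_indicator hB, Measure.restrict_restrict hB, inter_eq_left.2 hBW]
    rw [hBi, ← lintegral_add_left hm1, ← lintegral_const_mul _ hgb]
    refine lintegral_mono fun y => ?_
    by_cases hy : y ∈ B
    · rw [indicator_of_mem hy, hξB y hy, sub_self, zero_add, ENNReal.ofReal_add zero_le_one hω.le,
        ENNReal.ofReal_one, add_mul, one_mul, add_comm]
    · rw [indicator_of_notMem hy, add_zero]
      gcongr
      linarith [h0 y]
  rw [lintegral_add_right _ hm1, add_assoc]
  refine (add_le_add e1 e2).trans (le_of_eq ?_)
  rw [mul_add]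
  ring

theorem tendsto_ofReal_nhdsGT_zero :
    Tendsto (fun ω : ℝ => ENNReal.ofReal ω) (𝓝[>] 0) (𝓝 0) := by
  have := (ENNReal.continuous_ofReal.tendsto 0).mono_left (nhdsWithin_le_nhds (s := Ioi (0 : ℝ)))
  rwa [ENNReal.ofReal_zero] at this

theorem tv_interpolate_add_le [BorelSpace X] {ξ a b : X → ℝ} {L : ℝ≥0} (hξ : LipschitzWith L ξ)
    (h0 : ∀ y, 0 ≤ ξ y) (h1 : ∀ y, ξ y ≤ 1) {U V W B : Set X} (hV : IsOpen V)
    (hTV : tsupport ξ ⊆ V) (hVc : IsCompact (closure V)) (hVU : closure V ⊆ U) (hUW : U ⊆ W)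
    (hμV : μ V ≠ ∞) (hB : IsOpen B) (hBW : B ⊆ W) (hξB : ∀ y ∈ B, ξ y = 1)
    (ha : AEMeasurable a (μ.restrict V)) (hb : AEMeasurable b (μ.restrict V)) :
    tv μ (fun y => ξ y * a y + (1 - ξ y) * b y) W + tv μ b B ≤
      tv μ a U + tv μ b W + L * ∫⁻ y in V, ENNReal.ofReal |a y - b y| ∂μ := by
  by_cases hAt : tv μ a U = ∞
  · simp [hAt]
  by_cases hBt : tv μ b W = ∞
  · simp [hBt]
  have hVU' : V ⊆ U := subset_closure.trans hVU
  have hTc : IsCompact (tsupport ξ) :=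
    hVc.of_isClosed_subset (isClosed_tsupport ξ) (hTV.trans subset_closure)
  have key : ∀ ω : ℝ, 0 < ω → tv μ (fun y => ξ y * a y + (1 - ξ y) * b y) W + tv μ b B ≤
      ENNReal.ofReal (1 + ω) * (tv μ a U + ENNReal.ofReal ω + (tv μ b W + ENNReal.ofReal ω)) +
      (L * ∫⁻ y in V, ENNReal.ofReal |a y - b y| ∂μ + L * (ENNReal.ofReal ω * μ V)) := by
    intro ω hω
    have hω' : ENNReal.ofReal ω ≠ 0 := by simpa using hω
    obtain ⟨v, g, hv, hvu, hgm, hg, hlt⟩ :=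
      exists_seq_of_tv_lt (ENNReal.lt_add_right hAt hω')
    obtain ⟨v', g', hv', hvu', hgm', hg', hlt'⟩ :=
      exists_seq_of_tv_lt (ENNReal.lt_add_right hBt hω')
    obtain ⟨G, hG⟩ : ∃ G : ℕ → X → ℝ≥0∞, ∀ i, G i = fun y =>
        V.indicator (fun y => ENNReal.ofReal (ξ y + ω) * g i y +
        L * ENNReal.ofReal (|v i y - v' i y| + ω)) y + ENNReal.ofReal (1 - ξ y + ω) * g' i y :=
      ⟨_, fun _ => rfl⟩
    have hGm : ∀ i, Measurable (G i) := fun i => by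
      have hm1 : Measurable fun y => ENNReal.ofReal (1 - ξ y + ω) * g' i y :=
        (((continuous_const.sub hξ.continuous).add continuous_const).measurable.ennreal_ofReal).mul
          (hgm' i)
      have hm2 : Measurable fun y => ENNReal.ofReal (ξ y + ω) * g i y :=
        ((hξ.continuous.add continuous_const).measurable.ennreal_ofReal).mul (hgm i)
      have hc : ContinuousOn (fun y => ENNReal.ofReal (|v i y - v' i y| + ω)) V :=
        ENNReal.continuous_ofReal.comp_continuousOn ((((hv i).continuousOn.mono hVU').sub
          ((hv' i).continuousOn.mono (hVU'.trans hUW))).abs.add continuousOn_const)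
      have hc' : ContinuousOn (fun y => L * ENNReal.ofReal (|v i y - v' i y| + ω)) V :=
        (ENNReal.continuous_const_mul ENNReal.coe_ne_top).comp_continuousOn hc
      rw [hG]
      refine Measurable.add ?_ hm1
      have := (hm2.indicator hV.measurableSet).add (measurable_indicator_of_continuousOn hV hc')
      rw [← indicator_add'] at this
      exact this
    have hGi : ∀ i, IsWeakUpperGradientOn μ (G i)
        (fun y => ξ y * v i y + (1 - ξ y) * v' i y) W := fun i => by
      rw [hG]
      exact IsWeakUpperGradientOn.interpolate hξ h0 h1 hV hTV hVU' (hVU'.trans hUW)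
        (hv i).continuousOn (hv' i).continuousOn (hg i) (hg' i) hω
    have t1 : tv μ (fun y => ξ y * a y + (1 - ξ y) * b y) W ≤
        liminf (fun i => ∫⁻ y in W, G i y ∂μ) atTop :=
      tv_le_liminf (v := fun i y => ξ y * v i y + (1 - ξ y) * v' i y)
        (fun i => LocLipschitzOn.interpolate hξ h0 h1 (hTV.trans hVU') hUW (hv i) (hv' i))
        (TendstoL1Loc.interpolate h0 h1 hTc (hTV.trans hVU') (fun i => (hv i).continuousOn)
          (ha.mono_set hTV) hvu hvu') hGm hGi
    have t2 : tv μ b B ≤ liminf (fun i => ∫⁻ y in B, g' i y ∂μ) atTop :=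
      tv_le_liminf (fun i => (hv' i).mono hBW) (hvu'.mono hBW) hgm' fun i => (hg' i).mono hBW
    refine (add_le_add t1 t2).trans ((liminf_add_liminf_le _ _).trans ?_)
    have hlim : Tendsto (fun i => ENNReal.ofReal (1 + ω) *
        (tv μ a U + ENNReal.ofReal ω + (tv μ b W + ENNReal.ofReal ω)) +
        L * (∫⁻ y in closure V, ENNReal.ofReal |v i y - a y| ∂μ +
      (∫⁻ y in closure V, ENNReal.ofReal |v' i y - b y| ∂μ +
      (∫⁻ y in V, ENNReal.ofReal |a y - b y| ∂μ + ENNReal.ofReal ω * μ V)))) atTop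
        (𝓝 (ENNReal.ofReal (1 + ω) *
        (tv μ a U + ENNReal.ofReal ω + (tv μ b W + ENNReal.ofReal ω)) +
        L * (0 + (0 +
      (∫⁻ y in V, ENNReal.ofReal |a y - b y| ∂μ + ENNReal.ofReal ω * μ V))))) :=
      tendsto_const_nhds.add (ENNReal.Tendsto.const_mul ((hvu _ hVc hVU).add
        ((hvu' _ hVc (hVU.trans hUW)).add tendsto_const_nhds)) (Or.inr ENNReal.coe_ne_top))
    rw [zero_add, zero_add] at hlim
    rw [← mul_add, ← hlim.liminf_eq]
    refine liminf_le_liminf (Eventually.of_forall fun i => ?_)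
    rw [hG]
    refine (lintegral_interpolate_energy_le hξ.continuous h0 h1 hV hB.measurableSet hVU' hBW hξB
      (hgm i) (hgm' i) hω).trans ?_
    gcongr
    · exact (hlt i).le
    · exact (hlt' i).le
    · exact lintegral_abs_sub_add_le hV ha hb ((hv i).continuousOn.mono hVU')
        ((hv' i).continuousOn.mono (hVU'.trans hUW)) hω
  have hω0 := tendsto_ofReal_nhdsGT_zero
  have hω1 : Tendsto (fun ω : ℝ => ENNReal.ofReal (1 + ω)) (𝓝[>] 0) (𝓝 1) := by
    have := ((ENNReal.continuous_ofReal.comp (continuous_const.add continuous_id)).tendsto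
      (0 : ℝ)).mono_left (nhdsWithin_le_nhds (s := Ioi (0 : ℝ))) (f := fun ω : ℝ =>
        ENNReal.ofReal (1 + ω))
    simpa using this
  have hlim := (ENNReal.Tendsto.mul hω1 (Or.inl one_ne_zero) ((tendsto_const_nhds.add hω0).add
      (tendsto_const_nhds.add hω0)) (Or.inr ENNReal.one_ne_top)
      (b := tv μ a U + 0 + (tv μ b W + 0))).add
    ((tendsto_const_nhds (x := L * ∫⁻ y in V, ENNReal.ofReal |a y - b y| ∂μ)).add
    (ENNReal.Tendsto.const_mul (ENNReal.Tendsto.mul_const hω0 (Or.inr hμV))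
      (Or.inr (ENNReal.coe_ne_top (r := L)))))
  refine (ge_of_tendsto hlim (eventually_nhdsWithin_of_forall fun ω hω => key ω hω)).trans ?_
  simp

theorem MMS.measure_ball_two_pow_le {Cd CP lam : ℝ} (hX : MMS μ Cd CP lam) (x : X) {r : ℝ}
    (hr : 0 < r) (m : ℕ) : μ (ball x (2 ^ m * r)) ≤ ENNReal.ofReal Cd ^ m * μ (ball x r) := by
  induction m with
  | zero => simp
  | succ m ih =>
    calc μ (ball x (2 ^ (m + 1) * r)) = μ (ball x (2 * (2 ^ m * r))) := by ring_nf
      _ ≤ ENNReal.ofReal Cd * μ (ball x (2 ^ m * r)) := (hX.doubling x _ (by positivity)).2.1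
      _ ≤ ENNReal.ofReal Cd * (ENNReal.ofReal Cd ^ m * μ (ball x r)) := by gcongr
      _ = ENNReal.ofReal Cd ^ (m + 1) * μ (ball x r) := by ring

theorem MMS.totallyBounded_ball [BorelSpace X] {Cd CP lam : ℝ} (hX : MMS μ Cd CP lam) (x : X)
    (R : ℝ) : TotallyBounded (ball x R) := by
  rw [Metric.totallyBounded_iff]
  intro ε hε
  by_contra! hno
  have hstep : ∀ s : Finset X, (∀ y ∈ s, y ∈ ball x R) →
      ∃ y, y ∈ ball x R ∧ ∀ z ∈ s, ε ≤ dist z y := fun s _ => by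
    obtain ⟨y, hy, hy'⟩ := not_subset.1 (hno s s.finite_toSet)
    refine ⟨y, hy, fun z hz => ?_⟩
    by_contra! hlt
    exact hy' (mem_iUnion₂.2 ⟨z, hz, by rwa [mem_ball, dist_comm]⟩)
  have : Std.Symm fun y z : X => ε ≤ dist y z := ⟨fun y z h => by rwa [dist_comm]⟩
  obtain ⟨f, hf, hsep⟩ := exists_seq_of_forall_finset_exists' _ _ hstep
  have hR : 0 < R := pos_of_mem_ball (hf 0)
  obtain ⟨m, hm⟩ := pow_unbounded_of_one_lt ((2 * R + ε) / (ε / 2)) one_lt_two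
  rw [div_lt_iff₀ (by positivity)] at hm
  have hlow : ∀ n, μ (ball x (R + ε)) ≤ ENNReal.ofReal Cd ^ m * μ (ball (f n) (ε / 2)) := fun n =>
    (measure_mono (ball_subset_ball' (by
      have := mem_ball'.1 (hf n)
      linarith))).trans (hX.measure_ball_two_pow_le (f n) (half_pos hε) m)
  have hpos : 0 < μ (ball x (R + ε)) := by
    have := (hX.doubling x ((R + ε) / 2) (by positivity)).1
    rwa [mul_div_cancel₀ _ (two_ne_zero' ℝ)] at this
  have hdisj : Pairwise (Function.onFun Disjoint fun n => ball (f n) (ε / 2)) := fun i j hij =>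
    ball_disjoint_ball (by
      have : ε ≤ dist (f i) (f j) := hsep hij
      linarith)
  have hsum : ∑' n, μ (ball (f n) (ε / 2)) ≤ μ (ball x (R + ε)) := by
    rw [← measure_iUnion hdisj fun n => measurableSet_ball]
    refine measure_mono (iUnion_subset fun n => ball_subset_ball' ?_)
    have := mem_ball.1 (hf n)
    linarith
  have htop : ∑' _ : ℕ, μ (ball x (R + ε)) ≤ ENNReal.ofReal Cd ^ m * μ (ball x (R + ε)) := by
    refine (ENNReal.tsum_le_tsum hlow).trans ?_
    rw [ENNReal.tsum_mul_left]
    gcongr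
  rw [ENNReal.tsum_const_eq_top_of_ne_zero hpos.ne', top_le_iff] at htop
  exact ENNReal.mul_ne_top (ENNReal.pow_ne_top ENNReal.ofReal_ne_top)
    (hX.doubling x (R + ε) (by positivity)).2.2.ne htop

theorem MMS.properSpace [BorelSpace X] {Cd CP lam : ℝ} (hX : MMS μ Cd CP lam) : ProperSpace X := by
  have := hX.complete
  refine ⟨fun x r => TotallyBounded.isCompact_of_isClosed ?_ isClosed_closedBall⟩
  exact (hX.totallyBounded_ball x (r + 1)).subset (closedBall_subset_ball (by linarith))

theorem MMS.measure_lt_top {Cd CP lam : ℝ} (hX : MMS μ Cd CP lam) {s : Set X}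
    (hs : Bornology.IsBounded s) : μ s < ∞ := by
  have := hX.nontrivial
  obtain ⟨x⟩ : Nonempty X := inferInstance
  obtain ⟨r, hr, h⟩ := hs.subset_ball_lt 0 x
  exact (measure_mono h).trans_lt (hX.doubling x r hr).2.2

/-- Lipschitz cutoff functions between concentric balls. -/
theorem exists_cutoff_ball (x : X) {s t : ℝ} (hst : s < t) :
    ∃ (L : ℝ≥0) (η : X → ℝ), (L : ℝ) = (t - s)⁻¹ ∧ LipschitzWith L η ∧ (∀ y, 0 ≤ η y) ∧
      (∀ y, η y ≤ 1) ∧ (∀ y ∈ ball x s, η y = 1) ∧ tsupport η ⊆ closedBall x t := by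
  have hδ : 0 < t - s := sub_pos.2 hst
  refine ⟨(t - s).toNNReal⁻¹, fun y => (thickenedIndicator hδ (ball x s) y : ℝ), ?_,
    ?_, fun y => NNReal.coe_nonneg _, fun y => ?_, fun y hy => ?_, ?_⟩
  · rw [NNReal.coe_inv, Real.coe_toNNReal _ hδ.le]
  · have := lipschitzWith_thickenedIndicator hδ (ball x s)
    exact LipschitzWith.of_dist_le_mul fun y z => this.dist_le_mul y z
  · exact_mod_cast thickenedIndicator_le_one hδ _ y
  · beta_reduce
    rw [thickenedIndicator_one hδ _ hy, NNReal.coe_one]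
  · refine closure_minimal (fun y hy => ?_) isClosed_closedBall
    by_contra hn
    refine hy ?_
    beta_reduce
    rw [thickenedIndicator_zero hδ, NNReal.coe_zero]
    intro h
    obtain ⟨z, hz, hyz⟩ := mem_thickening_iff.1 h
    refine hn (mem_closedBall.2 ?_)
    have := dist_triangle y z x
    rw [mem_ball] at hz
    linarith

/-- Lipschitz cutoff functions for compact subsets of open sets. -/
theorem exists_cutoff_isCompact {K U : Set X} (hK : IsCompact K) (hU : IsOpen U) (hKU : K ⊆ U) :
    ∃ (L : ℝ≥0) (η : X → ℝ), LipschitzWith L η ∧ (∀ y, 0 ≤ η y) ∧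
      (∀ y, η y ≤ 1) ∧ (∀ y ∈ K, η y = 1) ∧ tsupport η ⊆ U := by
  obtain ⟨δ, hδ, hsub⟩ := hK.exists_cthickening_subset_open hU hKU
  refine ⟨δ.toNNReal⁻¹, fun y => (thickenedIndicator hδ K y : ℝ),
    ?_, fun y => NNReal.coe_nonneg _, fun y => ?_, fun y hy => ?_, ?_⟩
  · have := lipschitzWith_thickenedIndicator hδ K
    exact LipschitzWith.of_dist_le_mul fun y z => this.dist_le_mul y z
  · exact_mod_cast thickenedIndicator_le_one hδ _ y
  · beta_reduce
    rw [thickenedIndicator_one hδ _ hy, NNReal.coe_one]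
  · refine (closure_minimal (fun y hy => ?_) isClosed_cthickening).trans hsub
    by_contra hn
    refine hy ?_
    beta_reduce
    rw [thickenedIndicator_zero hδ, NNReal.coe_zero]
    exact fun h => hn (thickening_subset_cthickening _ _ h)

theorem MemBVloc.aemeasurable {u : X → ℝ} {Ω : Set X} (h : MemBVloc μ u Ω) (K : Set X)
    (hK : IsCompact K) (hKΩ : K ⊆ Ω) : AEMeasurable u (μ.restrict K) := by
  obtain ⟨U, -, hKU, -, hint, -⟩ := h K hK hKΩ
  exact hint.aemeasurable.mono_set hKU

/-- Pushing `(u - k)₊` down by a cutoff function, in terms of total variations. -/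
theorem tv_sub_cutoff_add_tv_le [BorelSpace X] [ProperSpace X] {u η : X → ℝ} {L : ℝ≥0}
    (hη : LipschitzWith L η) (h0 : ∀ y, 0 ≤ η y) (h1 : ∀ y, η y ≤ 1)
    (hT : IsCompact (tsupport η)) {U D B : Set X} (hU : IsOpen U) (hD : IsOpen D)
    (hTU : tsupport η ⊆ U) (hTD : tsupport η ⊆ D) (hμD : μ D ≠ ∞) (hB : IsOpen B)
    (hηB : ∀ y ∈ B, η y = 1)
    (hu : ∀ K, IsCompact K → K ⊆ U → AEMeasurable u (μ.restrict K)) (k : ℝ) {ε : ℝ}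
    (hε : 0 ≤ ε) :
    tv μ (fun y => u y + -(η y * (max (u y - k) 0 + ε))) U +
        tv μ (fun y => max (u y - k) 0) B ≤
      tv μ (fun y => min (u y) k) U + tv μ (fun y => max (u y - k) 0) U +
        L * (∫⁻ y in D, ENNReal.ofReal (max (u y - k) 0) ∂μ + ENNReal.ofReal ε * μ D) := by
  have hBT : B ⊆ tsupport η := fun y hy => subset_tsupport η (by simp [hηB y hy])
  obtain ⟨V, hV, hTV, hVUD, hVc⟩ :=
    exists_open_between_and_isCompact_closure hT (hU.inter hD) (subset_inter hTU hTD)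
  have hVU : closure V ⊆ U := hVUD.trans inter_subset_left
  have hVD : V ⊆ D := (subset_closure.trans hVUD).trans inter_subset_right
  have huV : AEMeasurable u (μ.restrict V) := (hu _ hVc hVU).mono_set subset_closure
  have hw : AEMeasurable (fun y => max (u y - k) 0) (μ.restrict V) :=
    (huV.sub aemeasurable_const).max aemeasurable_const
  have key := tv_interpolate_add_le (a := fun _ => -ε) hη h0 h1 hV hTV hVc hVU Subset.rfl
    ((measure_mono hVD).trans_lt hμD.lt_top).ne hB (hBT.trans hTU) hηB aemeasurable_const hw
  rw [tv_const, zero_add] at key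
  have hdec : tv μ (fun y => u y + -(η y * (max (u y - k) 0 + ε))) U ≤
      tv μ (fun y => min (u y) k) U +
        tv μ (fun y => η y * -ε + (1 - η y) * max (u y - k) 0) U := by
    have he : (fun y => u y + -(η y * (max (u y - k) 0 + ε))) =
        fun y => min (u y) k + (η y * -ε + (1 - η y) * max (u y - k) 0) := by
      ext y
      have : u y = min (u y) k + max (u y - k) 0 := by
        rcases le_total (u y) k with h | h
        · rw [min_eq_left h, max_eq_right (by linarith)]; ring
        · rw [min_eq_right h, max_eq_left (by linarith)]; ring
      linear_combination this
    rw [he]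
    exact tv_add_le fun K hK hKU => (hu K hK hKU).min aemeasurable_const
  have hint : ∫⁻ y in V, ENNReal.ofReal |-ε - max (u y - k) 0| ∂μ ≤
      ∫⁻ y in D, ENNReal.ofReal (max (u y - k) 0) ∂μ + ENNReal.ofReal ε * μ D := by
    rw [← setLIntegral_const, ← lintegral_add_right _ measurable_const]
    refine (lintegral_mono_set hVD).trans (lintegral_mono fun y => ?_)
    rw [← ENNReal.ofReal_add (le_max_right _ _) hε]
    refine ENNReal.ofReal_le_ofReal (le_of_eq ?_)
    have : 0 ≤ max (u y - k) 0 := le_max_right _ _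
    rw [abs_of_nonpos (by linarith)]
    ring
  calc _ ≤ tv μ (fun y => min (u y) k) U +
        tv μ (fun y => η y * -ε + (1 - η y) * max (u y - k) 0) U +
        tv μ (fun y => max (u y - k) 0) B := by gcongr
    _ ≤ tv μ (fun y => min (u y) k) U + (tv μ (fun y => max (u y - k) 0) U +
        L * ∫⁻ y in V, ENNReal.ofReal |-ε - max (u y - k) 0| ∂μ) := by
      rw [add_assoc]
      gcongr
    _ ≤ _ := by
      rw [← add_assoc]
      gcongr

theorem memBV_neg_cutoff_mul [BorelSpace X] [ProperSpace X] {u η : X → ℝ} {L : ℝ≥0}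
    (hη : LipschitzWith L η) (h0 : ∀ y, 0 ≤ η y) (h1 : ∀ y, η y ≤ 1)
    (hT : IsCompact (tsupport η)) {U D Ω : Set X} (hU : IsOpen U) (hD : IsOpen D)
    (hTU : tsupport η ⊆ U) (hTD : tsupport η ⊆ D) (hμD : μ D ≠ ∞) (hUΩ : U ⊆ Ω)
    (hu : MemBV μ u U) (k ε : ℝ) :
    MemBV μ (fun y => -(η y * (max (u y - k) 0 + ε))) Ω := by
  obtain ⟨V, hV, hTV, hVUD, hVc⟩ :=
    exists_open_between_and_isCompact_closure hT (hU.inter hD) (subset_inter hTU hTD)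
  have hVU : closure V ⊆ U := hVUD.trans inter_subset_left
  have hVU' : V ⊆ U := subset_closure.trans hVU
  have hVD : V ⊆ D := (subset_closure.trans hVUD).trans inter_subset_right
  have hμV : μ V ≠ ∞ := ((measure_mono hVD).trans_lt hμD.lt_top).ne
  have hwV : IntegrableOn (fun y => -(max (u y - k) 0 + ε)) V μ := by
    have hc : ∀ c : ℝ, IntegrableOn (fun _ => c) V μ := fun c => integrableOn_const hμV
    exact ((((hu.1.mono_set hVU').sub (hc k)).pos_part).add (hc ε)).neg
  have hF : LipschitzWith 1 fun t : ℝ => -(max (t - k) 0 + ε) :=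
    LipschitzWith.of_dist_le_mul fun a b => by
      have := (lipschitzWith_posPart k).dist_le_mul a b
      rw [Real.dist_eq] at this ⊢
      rwa [show -(max (a - k) 0 + ε) - -(max (b - k) 0 + ε) =
        -(max (a - k) 0 - max (b - k) 0) by ring, abs_neg]
  constructor
  · have hφV : IntegrableOn (fun y => -(η y * (max (u y - k) 0 + ε))) V μ := by
      refine Integrable.mono hwV ?_ (Eventually.of_forall fun y => ?_)
      · have := hη.continuous.aestronglyMeasurable (μ := μ.restrict V) |>.mul hwV.1
        refine this.congr (Eventually.of_forall fun y => ?_)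
        simp only [Pi.mul_apply, mul_neg]
      · rw [norm_neg, norm_neg, norm_mul, Real.norm_of_nonneg (h0 y)]
        exact mul_le_of_le_one_left (norm_nonneg _) (h1 y)
    refine (integrableOn_iff_integrable_of_support_subset ?_ |>.1 hφV).integrableOn
    refine fun y hy => hTV (subset_tsupport η fun h => hy ?_)
    simp [h]
  · have key := tv_interpolate_add_le (μ := μ) (a := fun y => -(max (u y - k) 0 + ε))
      (b := fun _ => 0) (B := ∅) hη h0 h1 hV hTV hVc hVU hUΩ hμV isOpen_empty (empty_subset _)
      (by simp) hwV.aemeasurable aemeasurable_const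
    rw [tv_const, tv_const, add_zero, add_zero] at key
    have he : (fun y => η y * -(max (u y - k) 0 + ε) + (1 - η y) * 0) =
        fun y => -(η y * (max (u y - k) 0 + ε)) := by
      ext y
      ring
    rw [he] at key
    refine key.trans_lt (ENNReal.add_lt_top.2 ⟨?_, ?_⟩)
    · exact (tv_comp_lipschitz_le hF).trans_lt hu.2
    · refine ENNReal.mul_lt_top ENNReal.coe_lt_top ?_
      simpa only [sub_zero, ← ofReal_norm, HasFiniteIntegral, Real.norm_eq_abs]
        using hwV.2

theorem tvs_le_tv {u : X → ℝ} {A U : Set X} (hU : IsOpen U) (hA : A ⊆ U) :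
    tvs μ u A ≤ tv μ u U :=
  iInf_le_of_le U (iInf_le_of_le hU (iInf_le_of_le hA le_rfl))

theorem exists_open_of_tvs_lt {u : X → ℝ} {A : Set X} {c : ℝ≥0∞} (h : tvs μ u A < c) :
    ∃ U, IsOpen U ∧ A ⊆ U ∧ tv μ u U < c := by
  simp only [tvs, iInf_lt_iff] at h
  obtain ⟨U, hU, hAU, hlt⟩ := h
  exact ⟨U, hU, hAU, hlt⟩

theorem tvs_min_add_tvs_posPart_le [BorelSpace X] (u : X → ℝ) (A : Set X) (k : ℝ) :
    tvs μ (fun y => min (u y) k) A + tvs μ (fun y => max (u y - k) 0) A ≤ tvs μ u A :=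
  le_iInf₂ fun _ hU => le_iInf fun hA =>
    (add_le_add (tvs_le_tv hU hA) (tvs_le_tv hU hA)).trans (tv_min_add_tv_posPart_le hU k)

theorem IsSubminimizer.tv_posPart_le [BorelSpace X] [ProperSpace X] {u η : X → ℝ} {L : ℝ≥0}
    {Ω D B : Set X} (hu : IsSubminimizer μ u Ω)
    (hη : LipschitzWith L η) (h0 : ∀ y, 0 ≤ η y) (h1 : ∀ y, η y ≤ 1)
    (hT : IsCompact (tsupport η)) (hD : IsOpen D) (hTD : tsupport η ⊆ D) (hDΩ : D ⊆ Ω)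
    (hμD : μ D ≠ ∞) (hB : IsOpen B) (hηB : ∀ y ∈ B, η y = 1) (k : ℝ) :
    tv μ (fun y => max (u y - k) 0) B ≤
      L * ∫⁻ y in D, ENNReal.ofReal (max (u y - k) 0) ∂μ := by
  obtain ⟨U₀, hU₀, hTU₀, hU₀Ω, hBV⟩ := hu.1 _ hT (hTD.trans hDΩ)
  have hsum := tvs_min_add_tvs_posPart_le (μ := μ) u (tsupport η) k
  have hfin : tvs μ u (tsupport η) < ∞ := (tvs_le_tv hU₀ hTU₀).trans_lt hBV.2
  obtain ⟨hp, hw⟩ := ENNReal.add_lt_top.1 (hsum.trans_lt hfin)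
  have key : ∀ ε : ℝ, 0 < ε → tv μ (fun y => max (u y - k) 0) B ≤
      ENNReal.ofReal ε + ENNReal.ofReal ε +
        (L * ∫⁻ y in D, ENNReal.ofReal (max (u y - k) 0) ∂μ + L * (ENNReal.ofReal ε * μ D)) := by
    intro ε hε
    have hε' : ENNReal.ofReal ε ≠ 0 := by simpa using hε
    obtain ⟨U₁, hU₁, hTU₁, hlt₁⟩ := exists_open_of_tvs_lt (ENNReal.lt_add_right hp.ne hε')
    obtain ⟨U₂, hU₂, hTU₂, hlt₂⟩ := exists_open_of_tvs_lt (ENNReal.lt_add_right hw.ne hε')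
    have hφ := memBV_neg_cutoff_mul hη h0 h1 hT hU₀ hD hTU₀ hTD hμD hU₀Ω hBV k ε
    have hsupp : tsupport (fun y => -(η y * (max (u y - k) 0 + ε))) = tsupport η := by
      have : Function.support (fun y => -(η y * (max (u y - k) 0 + ε))) =
          Function.support η := by
        ext y
        have : 0 ≤ max (u y - k) 0 := le_max_right _ _
        have : max (u y - k) 0 + ε ≠ 0 := by positivity
        simp [this]
      rw [tsupport, tsupport, this]
    have hmin := hu.2 _ ⟨hφ, hsupp ▸ hT, hsupp ▸ hTD.trans hDΩ⟩ fun y =>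
      neg_nonpos.2 (mul_nonneg (h0 y) (add_nonneg (le_max_right _ _) hε.le))
    rw [hsupp] at hmin
    obtain ⟨U, hUdef⟩ : ∃ U, U = U₁ ∩ U₂ ∩ U₀ := ⟨_, rfl⟩
    have hU : IsOpen U := hUdef ▸ (hU₁.inter hU₂).inter hU₀
    have hTU : tsupport η ⊆ U := hUdef ▸ subset_inter (subset_inter hTU₁ hTU₂) hTU₀
    have hUU₁ : U ⊆ U₁ := hUdef ▸ fun y hy => hy.1.1
    have hUU₂ : U ⊆ U₂ := hUdef ▸ fun y hy => hy.1.2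
    have hUU₀ : U ⊆ U₀ := hUdef ▸ fun y hy => hy.2
    have hA := tv_sub_cutoff_add_tv_le hη h0 h1 hT hU hD hTU hTD hμD hB hηB
      (fun K _ hKU => hBV.1.aemeasurable.mono_set (hKU.trans hUU₀)) k hε.le
    have htot : tvs μ (fun y => min (u y) k) (tsupport η) +
        tvs μ (fun y => max (u y - k) 0) (tsupport η) + tv μ (fun y => max (u y - k) 0) B ≤
        tvs μ (fun y => min (u y) k) (tsupport η) +
        tvs μ (fun y => max (u y - k) 0) (tsupport η) + (ENNReal.ofReal ε + ENNReal.ofReal ε +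
        (L * ∫⁻ y in D, ENNReal.ofReal (max (u y - k) 0) ∂μ +
          L * (ENNReal.ofReal ε * μ D))) := by
      calc _ ≤ tv μ (fun y => u y + -(η y * (max (u y - k) 0 + ε))) U +
            tv μ (fun y => max (u y - k) 0) B := by
            gcongr
            exact (hsum.trans hmin).trans (tvs_le_tv hU hTU)
        _ ≤ _ := hA
        _ ≤ (tvs μ (fun y => min (u y) k) (tsupport η) + ENNReal.ofReal ε) +
            (tvs μ (fun y => max (u y - k) 0) (tsupport η) + ENNReal.ofReal ε) +
            L * (∫⁻ y in D, ENNReal.ofReal (max (u y - k) 0) ∂μ + ENNReal.ofReal ε * μ D) := by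
            gcongr
            · exact (tv_mono hUU₁).trans hlt₁.le
            · exact (tv_mono hUU₂).trans hlt₂.le
        _ = _ := by ring
    exact (ENNReal.add_le_add_iff_left (ENNReal.add_lt_top.2 ⟨hp, hw⟩).ne).1 htot
  have hω0 := tendsto_ofReal_nhdsGT_zero
  have hlim := (hω0.add hω0).add
    ((tendsto_const_nhds (x := L * ∫⁻ y in D, ENNReal.ofReal (max (u y - k) 0) ∂μ)).add
    (ENNReal.Tendsto.const_mul (ENNReal.Tendsto.mul_const hω0 (Or.inr hμD))
      (Or.inr (ENNReal.coe_ne_top (r := L)))))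
  refine (ge_of_tendsto hlim (eventually_nhdsWithin_of_forall fun ω hω => key ω hω)).trans ?_
  simp

theorem IsObstacleSolution.tv_lt_top [BorelSpace X] [ProperSpace X]
    [IsFiniteMeasureOnCompacts μ] {u f : X → ℝ} {ψ : X → EReal}
    {Ω : Set X} (hu : IsObstacleSolution μ ψ f Ω u) (hΩ : Bornology.IsBounded Ω)
    (hf : LocallyIntegrable f μ) (hfv : tv μ f univ < ∞) : tv μ u univ < ∞ := by
  have hΩc : IsCompact (closure Ω) := hΩ.isCompact_closure
  obtain ⟨U₀, hU₀, hΩU₀, -, hBV⟩ := hu.1.1 _ hΩc (subset_univ _)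
  obtain ⟨V, hV, hΩV, hVU, hVc⟩ := exists_open_between_and_isCompact_closure hΩc hU₀ hΩU₀
  obtain ⟨L, ξ, hξ, h0, h1, hξ1, hTV⟩ := exists_cutoff_isCompact hΩc hV hΩV
  have hfV : IntegrableOn f V μ := (hf.integrableOn_isCompact hVc).mono_set subset_closure
  have huV : IntegrableOn u V μ := hBV.1.mono_set (subset_closure.trans hVU)
  have hμV : μ V ≠ ∞ := ((measure_mono subset_closure).trans_lt hVc.measure_lt_top).ne
  have key := tv_interpolate_add_le (μ := μ) (a := u) (b := f) (B := ∅) hξ h0 h1 hV hTV hVc hVU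
    (subset_univ _) hμV isOpen_empty (empty_subset _) (by simp) huV.aemeasurable hfV.aemeasurable
  have hfin : ∫⁻ y in V, ENNReal.ofReal |u y - f y| ∂μ < ∞ := by
    simpa only [← ofReal_norm, HasFiniteIntegral, Real.norm_eq_abs,
      Pi.sub_apply] using (huV.sub hfV).2
  refine (tv_le_of_ae_eq ?_).trans_lt ((le_self_add.trans key).trans_lt (ENNReal.add_lt_top.2
    ⟨ENNReal.add_lt_top.2 ⟨hBV.2, hfv⟩, ENNReal.mul_lt_top ENNReal.coe_lt_top hfin⟩))
  filter_upwards [hu.1.2.2] with y hy _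
  by_cases hyΩ : y ∈ Ω
  · rw [hξ1 y (subset_closure hyΩ)]
    ring
  · rw [hy hyΩ]
    ring

theorem IsObstacleSolution.tv_posPart_le [BorelSpace X] [ProperSpace X] {u f η : X → ℝ}
    {ψ : X → EReal} {L : ℝ≥0} {Ω D B : Set X} (hu : IsObstacleSolution μ ψ f Ω u)
    (hfin : tv μ u univ < ∞)
    (hη : LipschitzWith L η) (h0 : ∀ y, 0 ≤ η y) (h1 : ∀ y, η y ≤ 1)
    (hT : IsCompact (tsupport η)) (hD : IsOpen D) (hTD : tsupport η ⊆ D) (hDΩ : D ⊆ Ω)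
    (hμD : μ D ≠ ∞) (hB : IsOpen B) (hηB : ∀ y ∈ B, η y = 1) {k : ℝ}
    (hψ : ∀ᵐ y ∂μ, y ∈ D → ψ y ≤ (k : EReal)) :
    tv μ (fun y => max (u y - k) 0) B ≤
      L * ∫⁻ y in D, ENNReal.ofReal (max (u y - k) 0) ∂μ := by
  obtain ⟨hBVloc, hobs, hbdry⟩ := hu.1
  obtain ⟨U₀, hU₀, hTU₀, -, hBV⟩ := hBVloc _ hT (subset_univ _)
  have hφ := memBV_neg_cutoff_mul hη h0 h1 hT hU₀ hD hTU₀ hTD hμD (subset_univ _) hBV k 0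
  have hη0 : ∀ y, y ∉ D → η y = 0 := fun y hy =>
    image_eq_zero_of_notMem_tsupport fun h => hy (hTD h)
  have hK : MemK μ ψ f Ω fun y => u y + -(η y * (max (u y - k) 0 + 0)) := by
    refine ⟨fun K hK _ => ?_, ?_, ?_⟩
    · obtain ⟨U, hU, hKU, -, hBVU⟩ := hBVloc K hK (subset_univ _)
      refine ⟨U, hU, hKU, subset_univ _, hBVU.1.add (hφ.1.mono_set (subset_univ _)), ?_⟩
      refine (tv_add_le fun K' _ hK'U => hBVU.1.aemeasurable.mono_set hK'U).trans_lt ?_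
      exact ENNReal.add_lt_top.2 ⟨hBVU.2, (tv_mono (subset_univ _)).trans_lt hφ.2⟩
    · filter_upwards [hobs, hψ] with y hy hyψ hyΩ
      by_cases hyD : y ∈ D
      · rcases le_total (u y) k with h | h
        · rw [max_eq_right (by linarith)]
          simpa using hy hyΩ
        · refine (hyψ hyD).trans (EReal.coe_le_coe_iff.2 ?_)
          rw [max_eq_left (by linarith)]
          nlinarith [h0 y, h1 y]
      · rw [hη0 y hyD]
        simpa using hy hyΩ
    · filter_upwards [hbdry] with y hy hyΩ
      rw [hη0 y fun h => hyΩ (hDΩ h)]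
      simpa using hy hyΩ
  have hmin := hu.2 _ hK
  have hA := tv_sub_cutoff_add_tv_le hη h0 h1 hT isOpen_univ hD (subset_univ _) hTD hμD hB hηB
    (fun K hK hKU => hBVloc.aemeasurable K hK hKU) k le_rfl
  have hsum := tv_min_add_tv_posPart_le (μ := μ) (u := u) isOpen_univ k
  rw [ENNReal.ofReal_zero, zero_mul, add_zero] at hA
  exact (ENNReal.add_le_add_iff_left (hsum.trans_lt hfin).ne).1
    ((add_le_add_left (hsum.trans hmin) _).trans hA)

end

/-- **De Giorgi-type inequality.** Suppose `k ∈ ℝ` and `B(x,s₂) ⋐ Ω`, and assume either that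
(a) `u` is a 1-subminimizer in `Ω`, or (b) `Ω` is bounded, `u` solves the `K_{ψ,f}(Ω)`-obstacle
problem and `ψ ≤ k` a.e. in `B(x,s₂)`. Then for `0 < s₁ < s₂`,
`‖D(u-k)₊‖(B(x,s₁)) ≤ (2/(s₂-s₁)) ∫_{B(x,s₂)} (u-k)₊ dμ`. -/
theorem de_giorgi_inequality
    {X : Type*} [MetricSpace X] [MeasurableSpace X] [BorelSpace X]
    (μ : Measure X) (Cd CP lam : ℝ) (hX : MMS μ Cd CP lam)
    (Ω : Set X) (hΩopen : IsOpen Ω) (x : X) (s₂ : ℝ) (hs₂ : 0 < s₂)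
    (hcpt : IsCompact (closure (Metric.ball x s₂)))
    (hsub : closure (Metric.ball x s₂) ⊆ Ω)
    (u : X → ℝ) (k : ℝ) (ψ : X → EReal) (f : X → ℝ)
    (hcase : IsSubminimizer μ u Ω ∨
      (Bornology.IsBounded Ω ∧ Ω.Nonempty ∧
        MeasureTheory.LocallyIntegrable f μ ∧ tv μ f Set.univ < ⊤ ∧
        IsObstacleSolution μ ψ f Ω u ∧
        (∀ᵐ y ∂μ, y ∈ Metric.ball x s₂ → ψ y ≤ (k : EReal)))) :
    ∀ s₁ : ℝ, 0 < s₁ → s₁ < s₂ →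
      tv μ (fun y => max (u y - k) 0) (Metric.ball x s₁) ≤
        ENNReal.ofReal (2 / (s₂ - s₁)) *
          ∫⁻ y in Metric.ball x s₂, ENNReal.ofReal (max (u y - k) 0) ∂μ := by
  intro s₁ _ hs
  have := hX.properSpace
  have : IsFiniteMeasureOnCompacts μ := ⟨fun K hK => hX.measure_lt_top hK.isBounded⟩
  obtain ⟨L, η, hL, hη, h0, h1, hη1, hTη⟩ := exists_cutoff_ball x (s := s₁) (t := (s₁ + s₂) / 2)
    (by linarith)
  have hTD : tsupport η ⊆ ball x s₂ := hTη.trans (closedBall_subset_ball (by linarith))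
  have hT : IsCompact (tsupport η) :=
    hcpt.of_isClosed_subset (isClosed_tsupport η) (hTD.trans subset_closure)
  have hDΩ : ball x s₂ ⊆ Ω := subset_closure.trans hsub
  have hμD : μ (ball x s₂) ≠ ∞ := (hX.doubling x s₂ hs₂).2.2.ne
  have hLe : ENNReal.ofReal (2 / (s₂ - s₁)) = L := by
    rw [← ENNReal.ofReal_coe_nnreal, hL, ← inv_div]
    ring_nf
  rw [hLe]
  rcases hcase with hu | ⟨hΩ, -, hf, hfv, hu, hψ⟩
  · exact hu.tv_posPart_le hη h0 h1 hT isOpen_ball hTD hDΩ hμD isOpen_ball hη1 k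
  · exact hu.tv_posPart_le (hu.tv_lt_top hΩ hf hfv) hη h0 h1 hT isOpen_ball hTD hDΩ hμD
      isOpen_ball hη1 hψ

end MetricBV
end
end

section
/- Let x ∈ X, 0 < R < (1/4) diam X, and let u ∈ BV(B(x,R)) be such that ‖D(u−k)₊‖(B(x,s₁)) ≤ (2/(s₂−s₁)) ∫_{B(x,s₂)} (u−k)₊ dμ holds for all 0 < s₁ < s₂ ≤ R and all k ≥ k* for some k* ∈ ℝ. Then for every k₀ ≥ k* and every r ∈ (0,R), esssup_{B(x,r)} u ≤ C₁ (R/(R−r))^Q ⨍_{B(x,R)} (u−k₀)₊ dμ + k₀, where C₁ is a constant depending only on C_d, C_P, λ. (Weak Harnack inequality.) -/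
open MeasureTheory Metric Filter Set
open scoped ENNReal NNReal Topology

noncomputable section

namespace MetricBV

variable {X : Type*} [MetricSpace X] [MeasurableSpace X]

namespace MMS

variable {μ : Measure X} {Cd CP lam : ℝ}

theorem measure_ball_pos (h : MMS μ Cd CP lam) (x : X) {r : ℝ} (hr : 0 < r) :
    0 < μ (ball x r) := by
  have := (h.doubling x (r / 2) (half_pos hr)).1
  rwa [mul_div_cancel₀ r two_ne_zero] at this

theorem measure_ball_lt_top (h : MMS μ Cd CP lam) (x : X) (r : ℝ) : μ (ball x r) < ⊤ := by
  rcases le_or_gt r 0 with hr | hr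
  · simp [ball_eq_empty.2 hr]
  · exact (h.doubling x r hr).2.2

theorem measure_ball_two_pow_le_s6 (h : MMS μ Cd CP lam) (x : X) {r : ℝ} (hr : 0 < r) (n : ℕ) :
    μ (ball x (2 ^ n * r)) ≤ ENNReal.ofReal Cd ^ n * μ (ball x r) := by
  induction n with
  | zero => simp
  | succ n ih =>
    calc μ (ball x (2 ^ (n + 1) * r)) = μ (ball x (2 * (2 ^ n * r))) := by rw [pow_succ']; ring_nf
      _ ≤ ENNReal.ofReal Cd * μ (ball x (2 ^ n * r)) :=
        (h.doubling x _ (by positivity)).2.1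
      _ ≤ ENNReal.ofReal Cd * (ENNReal.ofReal Cd ^ n * μ (ball x r)) := by gcongr
      _ = _ := by rw [pow_succ']; ring

/-- In a doubling space, balls of a fixed radius centred in a bounded region have measure bounded
away from zero. -/
theorem exists_le_measure_ball (h : MMS μ Cd CP lam) (x : X) (R : ℝ) {r : ℝ} (hr : 0 < r) :
    ∃ m : ℝ≥0∞, m ≠ 0 ∧ ∀ y ∈ closedBall x R, m ≤ μ (ball y r) := by
  obtain ⟨n, hn⟩ := pow_unbounded_of_one_lt ((R + 1) / r) (one_lt_two : (1 : ℝ) < 2)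
  rcases lt_or_ge R 0 with hR | hR
  · exact ⟨1, one_ne_zero, by simp [closedBall_eq_empty.2 hR]⟩
  have hn' : R + 1 < 2 ^ n * r := by rwa [div_lt_iff₀ hr] at hn
  refine ⟨μ (ball x 1) / ENNReal.ofReal Cd ^ n, ?_, fun y hy => ?_⟩
  · exact (ENNReal.div_pos (h.measure_ball_pos x one_pos).ne' (by finiteness)).ne'
  · refine ENNReal.div_le_of_le_mul' (le_trans (measure_mono ?_) (h.measure_ball_two_pow_le_s6 y hr n))
    refine ball_subset_ball' ?_
    rw [mem_closedBall, dist_comm] at hy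
    linarith

theorem properSpace_s6 [BorelSpace X] (h : MMS μ Cd CP lam) : ProperSpace X := by
  have := h.complete
  refine ⟨fun x R => isCompact_iff_totallyBounded_isComplete.2 ⟨?_, isClosed_closedBall.isComplete⟩⟩
  rw [Metric.totallyBounded_iff]
  intro ε hε
  have hsep : ∀ N : Set X, N ⊆ closedBall x R → N.Pairwise (fun y z => ε ≤ dist y z) →
      N.Finite := by
    intro N hN hsep
    obtain ⟨m, hm, hle⟩ := h.exists_le_measure_ball x R (half_pos hε)
    have hfin := Measure.finite_const_le_meas_of_disjoint_iUnion μ (pos_iff_ne_zero.2 hm)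
      (As := fun y : N => ball (y : X) (ε / 2)) (fun _ => measurableSet_ball) ?_ ?_
    · have huniv : {y : N | m ≤ μ (ball (y : X) (ε / 2))} = Set.univ :=
        Set.eq_univ_of_forall fun y => hle _ (hN y.2)
      rw [huniv, Set.finite_univ_iff] at hfin
      exact Set.toFinite N
    · intro y z hyz
      refine ball_disjoint_ball ?_
      rw [add_halves]
      exact hsep y.2 z.2 (fun e => hyz (Subtype.ext e))
    · refine ne_top_of_le_ne_top (h.measure_ball_lt_top x (ε / 2 + R)).ne
        (measure_mono (Set.iUnion_subset fun y => ball_subset_ball' ?_))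
      have := hN y.2
      rw [mem_closedBall] at this
      linarith
  obtain ⟨N, hN⟩ := zorn_subset {N : Set X | N ⊆ closedBall x R ∧
      N.Pairwise (fun y z => ε ≤ dist y z)} (by
    intro c hc hchain
    refine ⟨⋃₀ c, ⟨Set.sUnion_subset fun s hs => (hc hs).1, ?_⟩,
      fun s hs => Set.subset_sUnion_of_mem hs⟩
    exact (Set.pairwise_sUnion hchain.directedOn).2 fun s hs => (hc hs).2)
  refine ⟨N, hsep N hN.prop.1 hN.prop.2, fun y hy => ?_⟩
  by_contra hcon
  simp only [Set.mem_iUnion, mem_ball, not_exists, not_lt] at hcon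
  have hins : insert y N ⊆ N := hN.le_of_ge (y := insert y N)
    ⟨Set.insert_subset hy hN.prop.1, hN.prop.2.insert fun z hz _ =>
      ⟨hcon z hz, (dist_comm y z) ▸ hcon z hz⟩⟩ (Set.subset_insert y N)
  have := hcon y (hins (Set.mem_insert y N))
  rw [dist_self] at this
  exact absurd this (not_le.2 hε)

end MMS

/-- If `ψ` is `1`-Lipschitz and locally constant off `C`, then the characteristic function of `C`
bounds the oscillation of `ψ` along curves. -/
theorem ofReal_abs_sub_le_curveIntegral_indicator {Y : Type*} [MetricSpace Y]
    (γ : Curve Y) {ψ : Y → ℝ} (hψ : LipschitzWith 1 ψ) {C : Set Y} (hC : ∀ z ∉ C, ∀ᶠ z' in 𝓝 z, ψ z' = ψ z)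
    {a b : ℝ} (ha : a ∈ Set.Icc (0 : ℝ) 1) (hb : b ∈ Set.Icc (0 : ℝ) 1) :
    ENNReal.ofReal |ψ (γ.toFun b) - ψ (γ.toFun a)| ≤ curveIntegral (C.indicator 1) γ := by
  obtain ⟨K, hK⟩ := γ.lipschitz
  set f : ℝ → ℝ := fun t => ψ (γ.toFun t) with hf
  have hsub : Set.uIcc a b ⊆ Set.Icc 0 1 := Set.uIcc_subset_Icc ha hb
  have hlip : LipschitzOnWith (1 * K) f (Set.Icc 0 1) := hψ.comp_lipschitzOnWith hK
  have hac : AbsolutelyContinuousOnInterval f a b :=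
    (hlip.mono hsub).absolutelyContinuousOnInterval
  have hderiv : ∀ t ∈ Set.Ioo (0 : ℝ) 1,
      ‖deriv f t‖ₑ ≤ C.indicator 1 (γ.toFun t) * speed γ.toFun t := by
    intro t ht
    by_cases hd : DifferentiableAt ℝ f t
    swap
    · simp [deriv_zero_of_not_differentiableAt hd]
    by_cases htC : γ.toFun t ∈ C
    · rw [Set.indicator_of_mem htC, Pi.one_apply, one_mul, speed]
      have hlim : Tendsto (fun h : ℝ => ‖h⁻¹ • (f (t + h) - f t)‖ₑ) (𝓝[≠] 0)
          (𝓝 ‖deriv f t‖ₑ) := hd.hasDerivAt.tendsto_slope_zero.enorm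
      rw [← hlim.limsup_eq]
      refine limsup_le_limsup (Eventually.of_forall fun h => ?_)
      simp only [hf]
      rw [← ofReal_norm, norm_smul, norm_inv, Real.norm_eq_abs, Real.norm_eq_abs, inv_mul_eq_div]
      refine ENNReal.ofReal_le_ofReal ?_
      gcongr
      simpa [Real.dist_eq] using hψ.dist_le_mul (γ.toFun (t + h)) (γ.toFun t)
    · have hcont : ContinuousAt γ.toFun t :=
        hK.continuousOn.continuousAt (Icc_mem_nhds ht.1 ht.2)
      have : f =ᶠ[𝓝 t] fun _ => f t := hcont.eventually (hC _ htC)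
      simp [this.deriv_eq]
  rw [curveIntegral, ← Real.enorm_eq_ofReal_abs]
  calc ‖ψ (γ.toFun b) - ψ (γ.toFun a)‖ₑ = ‖∫ t in a..b, deriv f t‖ₑ := by
        rw [hac.integral_deriv_eq_sub]
    _ = ‖∫ t in Set.uIoc a b, deriv f t‖ₑ := by
        rw [← ofReal_norm, intervalIntegral.norm_intervalIntegral_eq, ofReal_norm]
    _ ≤ ∫⁻ t in Set.uIoc a b, ‖deriv f t‖ₑ := enorm_integral_le_lintegral_enorm _
    _ ≤ ∫⁻ t in Set.Icc (0 : ℝ) 1, ‖deriv f t‖ₑ :=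
        lintegral_mono_set (Set.uIoc_subset_uIcc.trans hsub)
    _ = ∫⁻ t in Set.Ioo (0 : ℝ) 1, ‖deriv f t‖ₑ := setLIntegral_congr Ioo_ae_eq_Icc.symm
    _ ≤ ∫⁻ t in Set.Ioo (0 : ℝ) 1, C.indicator 1 (γ.toFun t) * speed γ.toFun t :=
        setLIntegral_mono' measurableSet_Ioo hderiv
    _ ≤ _ := lintegral_mono_set Set.Ioo_subset_Icc_self

open scoped Classical in
/-- A function with a weak upper gradient in `Ω` that is bounded by `M` on a closed ball
`closedBall x t' ⊆ Ω` extends by zero to a function with an upper gradient in the whole space; the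
new upper gradient is infinite off the smaller ball `ball x t`. -/
theorem isUpperGradientOn_univ_indicator {X : Type*} [MetricSpace X] {v : X → ℝ} {g ρ : X → ℝ≥0∞} {Ω : Set X} {x : X}
    {t t' M : ℝ} (htt' : t < t') (hsub : closedBall x t' ⊆ Ω) {Γ : Set (Curve X)}
    (hg : ∀ γ : Curve X, γ ∉ Γ → γ.In Ω →
      ENNReal.ofReal |v (γ.toFun 1) - v (γ.toFun 0)| ≤ curveIntegral g γ)
    (hρ : ∀ γ ∈ Γ, 1 ≤ curveIntegral ρ γ) (hM : ∀ z ∈ closedBall x t', |v z| ≤ M) :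
    IsUpperGradientOn ((ball x t).piecewise (fun z => g z + ENNReal.ofReal (2 * M) * ρ z)
      fun _ => ⊤) ((closedBall x t').indicator v) Set.univ := by
  intro γ _
  set G := (ball x t).piecewise (fun z => g z + ENNReal.ofReal (2 * M) * ρ z) fun _ => ⊤ with hG
  have hGle : ∀ z, g z + ENNReal.ofReal (2 * M) * ρ z ≤ G z := by
    intro z
    by_cases hz : z ∈ ball x t
    · simp [hG, Set.piecewise_eq_of_mem _ _ _ hz]
    · simp [hG, Set.piecewise_eq_of_notMem _ _ _ hz]
  have h0 : (0 : ℝ) ∈ Set.Icc (0 : ℝ) 1 := by simp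
  have h1 : (1 : ℝ) ∈ Set.Icc (0 : ℝ) 1 := by simp
  by_cases hin : γ.In (closedBall x t')
  · rw [Set.indicator_of_mem (hin 1 h1), Set.indicator_of_mem (hin 0 h0)]
    by_cases hγ : γ ∈ Γ
    · calc ENNReal.ofReal |v (γ.toFun 1) - v (γ.toFun 0)| ≤ ENNReal.ofReal (2 * M) * 1 := by
            rw [mul_one]
            refine ENNReal.ofReal_le_ofReal ((abs_sub _ _).trans ?_)
            linarith [hM _ (hin 1 h1), hM _ (hin 0 h0)]
        _ ≤ ENNReal.ofReal (2 * M) * curveIntegral ρ γ := by gcongr; exact hρ γ hγ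
        _ ≤ ∫⁻ s in Set.Icc (0 : ℝ) 1,
              ENNReal.ofReal (2 * M) * (ρ (γ.toFun s) * speed γ.toFun s) :=
            lintegral_const_mul_le _ _
        _ ≤ curveIntegral G γ := by
            refine lintegral_mono fun s => ?_
            rw [← mul_assoc]
            gcongr
            exact le_add_self.trans (hGle _)
    · refine (hg γ hγ fun s hs => hsub (hin s hs)).trans (lintegral_mono fun s => ?_)
      gcongr
      exact le_self_add.trans (hGle _)
  · rcases eq_or_ne ((closedBall x t').indicator v (γ.toFun 1))
      ((closedBall x t').indicator v (γ.toFun 0)) with heq | hne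
    · simp [heq]
    obtain ⟨τ, hτ, hτx⟩ : ∃ τ ∈ Set.Icc (0 : ℝ) 1, γ.toFun τ ∉ closedBall x t' := by
      simpa only [Curve.In, not_forall, exists_prop] using hin
    obtain ⟨e, he, hex⟩ : ∃ e ∈ Set.Icc (0 : ℝ) 1, γ.toFun e ∈ closedBall x t' := by
      by_contra! hcon
      exact hne (by rw [Set.indicator_of_notMem (hcon 1 h1), Set.indicator_of_notMem (hcon 0 h0)])
    have hψ : LipschitzWith 1 fun z => max (dist z x) t := (LipschitzWith.dist_left x).max_const t
    have hosc := ofReal_abs_sub_le_curveIntegral_indicator γ hψ (C := (ball x t)ᶜ) (fun z hz => by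
      rw [Set.notMem_compl_iff] at hz
      filter_upwards [isOpen_ball.mem_nhds hz] with z' hz'
      rw [max_eq_right (mem_ball.1 hz').le, max_eq_right (mem_ball.1 hz).le]) he hτ
    have hpos : 0 < curveIntegral ((ball x t)ᶜ.indicator 1) γ := by
      refine lt_of_lt_of_le (ENNReal.ofReal_pos.2 (abs_pos.2 (sub_ne_zero.2 (ne_of_gt ?_)))) hosc
      rw [mem_closedBall] at hex
      rw [mem_closedBall, not_le] at hτx
      exact lt_max_of_lt_left (max_lt (hex.trans_lt hτx) (htt'.trans hτx))
    have htop : curveIntegral G γ = ⊤ := by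
      rw [eq_top_iff, ← ENNReal.top_mul hpos.ne']
      refine (lintegral_const_mul_le _ _).trans (lintegral_mono fun s => ?_)
      by_cases hs : γ.toFun s ∈ ball x t
      · simp [hs]
      · simp [hG, hs]
    rw [htop]
    exact le_top

/-- The Poincaré inequality for a function that is locally Lipschitz on a ball only. -/
theorem MMS.exists_lintegral_sub_const_le [BorelSpace X] {μ : Measure X} {Cd CP lam : ℝ}
    (h : MMS μ Cd CP lam) {x : X} {t s : ℝ} (hts : t < s) {v : X → ℝ}
    (hv : LocLipschitzOn v (ball x s)) {g : X → ℝ≥0∞} (hgm : Measurable g)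
    (hg : IsWeakUpperGradientOn μ g v (ball x s)) {y : X} {ρ : ℝ} (hρ : 0 < ρ)
    (hsub : ball y (lam * ρ) ⊆ ball x t) :
    ∃ c : ℝ, ∫⁻ z in ball y ρ, ENNReal.ofReal |v z - c| ∂μ ≤
      ENNReal.ofReal (CP * ρ) * ∫⁻ z in ball y (lam * ρ), g z ∂μ := by
  classical
  have := h.properSpace_s6
  obtain ⟨t', htt', ht's⟩ := exists_between hts
  have hK : closedBall x t' ⊆ ball x s := closedBall_subset_ball ht's
  have hcont : ContinuousOn v (closedBall x t') := by
    obtain ⟨L, hL⟩ := hv _ (isCompact_closedBall x t') hK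
    exact hL.continuousOn
  obtain ⟨M, hM⟩ := (isCompact_closedBall x t').exists_bound_of_continuousOn hcont
  have hfm : IsFiniteMeasureOnCompacts μ := ⟨fun K hK => by
    obtain ⟨r, hr⟩ := hK.isBounded.subset_ball x
    exact (measure_mono hr).trans_lt (h.measure_ball_lt_top x r)⟩
  set w := (closedBall x t').indicator v with hw
  have hwint : LocallyIntegrable w μ :=
    ((hcont.integrableOn_compact (isCompact_closedBall x t')).integrable_indicator
      measurableSet_closedBall).locallyIntegrable
  have hsubρ : ball y ρ ⊆ ball y (lam * ρ) :=
    ball_subset_ball (le_mul_of_one_le_left hρ.le h.hlam)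
  refine ⟨⨍ z in ball y ρ, w z ∂μ, ?_⟩
  have hwv : ∀ z ∈ ball y ρ, w z = v z := fun z hz =>
    Set.indicator_of_mem (ball_subset_closedBall (ball_subset_ball htt'.le (hsub (hsubρ hz)))) v
  obtain ⟨Γ, hΓ, hg⟩ := hg
  have key : ∀ δ : ℝ≥0∞, 0 < δ → ∫⁻ z in ball y ρ, ENNReal.ofReal |v z - ⨍ z in ball y ρ, w z ∂μ| ∂μ
      ≤ ENNReal.ofReal (CP * ρ) *
        (∫⁻ z in ball y (lam * ρ), g z ∂μ + ENNReal.ofReal (2 * M) * δ) := by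
    intro δ hδ
    obtain ⟨η, hηm, hη, hηδ⟩ : ∃ η : X → ℝ≥0∞, Measurable η ∧
        (∀ γ ∈ Γ, 1 ≤ curveIntegral η γ) ∧ ∫⁻ z, η z ∂μ < δ := by
      have := hΓ.trans_lt hδ
      simpa only [Mod1, iInf_lt_iff, exists_prop] using this
    have hP := h.poincare y ρ hρ w hwint _
      ((hgm.add (hηm.const_mul (ENNReal.ofReal (2 * M)))).piecewise measurableSet_ball
        (measurable_const (a := (⊤ : ℝ≥0∞))))
      (isUpperGradientOn_univ_indicator htt' hK hg hη hM)
    calc ∫⁻ z in ball y ρ, ENNReal.ofReal |v z - ⨍ z in ball y ρ, w z ∂μ| ∂μ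
        = ∫⁻ z in ball y ρ, ENNReal.ofReal |w z - ⨍ z in ball y ρ, w z ∂μ| ∂μ :=
          setLIntegral_congr_fun measurableSet_ball fun z hz => by rw [hwv z hz]
      _ ≤ _ := hP
      _ ≤ ENNReal.ofReal (CP * ρ) * 1 * ∫⁻ z in ball y (lam * ρ),
            (g z + ENNReal.ofReal (2 * M) * η z) ∂μ := by
          refine mul_le_mul' ?_ (setLIntegral_mono' measurableSet_ball fun z hz => ?_)
          · gcongr
            exact ENNReal.div_le_of_le_mul (by rw [one_mul]; exact measure_mono hsubρ)
          · simp [Set.piecewise_eq_of_mem _ _ _ (hsub hz)]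
      _ ≤ _ := by
          rw [mul_one, lintegral_add_left hgm, lintegral_const_mul _ hηm]
          gcongr
          exact (setLIntegral_le_lintegral _ _).trans hηδ.le
  have hlim : Tendsto (fun δ : ℝ≥0∞ => ENNReal.ofReal (CP * ρ) *
      (∫⁻ z in ball y (lam * ρ), g z ∂μ + ENNReal.ofReal (2 * M) * δ)) (𝓝[>] 0)
      (𝓝 (ENNReal.ofReal (CP * ρ) *
      (∫⁻ z in ball y (lam * ρ), g z ∂μ + ENNReal.ofReal (2 * M) * 0))) := by
    refine Tendsto.mono_left ?_ nhdsWithin_le_nhds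
    exact ENNReal.Tendsto.const_mul (tendsto_const_nhds.add
      (ENNReal.Tendsto.const_mul tendsto_id (Or.inr ENNReal.ofReal_ne_top)))
      (Or.inr ENNReal.ofReal_ne_top)
  rw [mul_zero, add_zero] at hlim
  exact ge_of_tendsto hlim (eventually_mem_nhdsWithin.mono key)

/-- If `f ≥ 0` vanishes on at least half of a ball, its integral is controlled by its oscillation
around any constant. -/
theorem lintegral_le_of_measure_ne_zero_le {α : Type*} [MeasurableSpace α] {ν : Measure α}
    {f : α → ℝ} (hf : AEMeasurable f ν) (hfin : ν Set.univ ≠ ⊤)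
    (hhalf : 2 * ν {z | f z ≠ 0} ≤ ν Set.univ) (c : ℝ) :
    ∫⁻ z, ENNReal.ofReal |f z| ∂ν ≤ 3 * ∫⁻ z, ENNReal.ofReal |f z - c| ∂ν := by
  have hZ : ν Set.univ ≤ 2 * ν {z | f z = 0} := by
    have h1 : ν Set.univ ≤ ν {z | f z = 0} + ν {z | f z ≠ 0} :=
      (measure_mono (fun z _ => em (f z = 0))).trans (measure_union_le _ _)
    have h2 : ν Set.univ + ν Set.univ ≤ 2 * ν {z | f z = 0} + ν Set.univ :=
      calc ν Set.univ + ν Set.univ = 2 * ν Set.univ := (two_mul _).symm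
        _ ≤ 2 * (ν {z | f z = 0} + ν {z | f z ≠ 0}) := by gcongr
        _ ≤ _ := by rw [mul_add]; gcongr
    exact (ENNReal.add_le_add_iff_right hfin).1 h2
  have hmk : ENNReal.ofReal |c| * ν {z | f z = 0} ≤ ∫⁻ z, ENNReal.ofReal |f z - c| ∂ν := by
    refine le_trans ?_ (mul_meas_ge_le_lintegral₀ (by fun_prop) (ENNReal.ofReal |c|))
    refine mul_le_mul_right (measure_mono fun z (hz : f z = 0) => ?_) _
    simp [hz]
  calc ∫⁻ z, ENNReal.ofReal |f z| ∂ν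
      ≤ ∫⁻ z, (ENNReal.ofReal |f z - c| + ENNReal.ofReal |c|) ∂ν := by
        refine lintegral_mono fun z => ?_
        rw [← ENNReal.ofReal_add (abs_nonneg _) (abs_nonneg _)]
        refine ENNReal.ofReal_le_ofReal ?_
        simpa using abs_add_le (f z - c) c
    _ = ∫⁻ z, ENNReal.ofReal |f z - c| ∂ν + ENNReal.ofReal |c| * ν Set.univ := by
        rw [lintegral_add_right _ measurable_const, lintegral_const]
    _ ≤ ∫⁻ z, ENNReal.ofReal |f z - c| ∂ν + 2 * (ENNReal.ofReal |c| * ν {z | f z = 0}) := by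
        rw [mul_left_comm]
        gcongr
    _ ≤ ∫⁻ z, ENNReal.ofReal |f z - c| ∂ν + 2 * ∫⁻ z, ENNReal.ofReal |f z - c| ∂ν := by gcongr
    _ = _ := by ring

section Averaging

variable [BorelSpace X] [SecondCountableTopology X] {μ : Measure X} [SFinite μ]

theorem measurable_measure_ball (ρ : ℝ) : Measurable fun y => μ (ball y ρ) := by
  have hs : MeasurableSet {p : X × X | dist p.2 p.1 < ρ} :=
    measurableSet_lt (by fun_prop) measurable_const
  exact measurable_measure_prodMk_left hs

theorem lintegral_mul_lintegral_ball {w F : X → ℝ≥0∞} (hw : Measurable w) (hF : AEMeasurable F μ)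
    (A : Set X) (ρ : ℝ) :
    ∫⁻ y in A, w y * ∫⁻ z in ball y ρ, F z ∂μ ∂μ =
      ∫⁻ z, F z * ∫⁻ y in A, (ball z ρ).indicator w y ∂μ ∂μ := by
  have hs : MeasurableSet {p : X × X | dist p.2 p.1 < ρ} :=
    measurableSet_lt (by fun_prop) measurable_const
  have hmeas : AEMeasurable (Function.uncurry fun y z => w y * (ball y ρ).indicator F z)
      ((μ.restrict A).prod μ) := by
    have : (Function.uncurry fun y z => w y * (ball y ρ).indicator F z) =
        {p : X × X | dist p.2 p.1 < ρ}.indicator fun p => w p.1 * F p.2 := by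
      ext ⟨y, z⟩
      by_cases hz : dist z y < ρ <;> simp [hz]
    rw [this]
    exact ((hw.comp measurable_fst).aemeasurable.mul
      (hF.comp_quasiMeasurePreserving Measure.quasiMeasurePreserving_snd)).indicator hs
  calc ∫⁻ y in A, w y * ∫⁻ z in ball y ρ, F z ∂μ ∂μ
      = ∫⁻ y in A, ∫⁻ z, w y * (ball y ρ).indicator F z ∂μ ∂μ := by
        refine lintegral_congr fun y => ?_
        rw [lintegral_const_mul'' _ (hF.indicator measurableSet_ball),
          lintegral_indicator measurableSet_ball]
    _ = ∫⁻ z, ∫⁻ y in A, w y * (ball y ρ).indicator F z ∂μ ∂μ := lintegral_lintegral_swap hmeas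
    _ = _ := by
        refine lintegral_congr fun z => ?_
        rw [← lintegral_const_mul _ (hw.indicator measurableSet_ball)]
        refine lintegral_congr fun y => ?_
        by_cases hz : dist z y < ρ
        · simp [hz, dist_comm y z, mul_comm]
        · simp [hz, dist_comm y z]

variable {Cd CP lam : ℝ}

theorem MMS.setLIntegral_ball_le_average (h : MMS μ Cd CP lam) {F : X → ℝ≥0∞}
    (hF : AEMeasurable F μ) (x : X) (r : ℝ) {ρ : ℝ} (hρ : 0 < ρ) :
    ∫⁻ z in ball x r, F z ∂μ ≤ ENNReal.ofReal Cd *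
      ∫⁻ y in ball x (r + ρ), (μ (ball y ρ))⁻¹ * ∫⁻ z in ball y ρ, F z ∂μ ∂μ := by
  have hCd : ENNReal.ofReal Cd ≠ 0 := (ENNReal.ofReal_pos.2 (one_pos.trans_le h.hCd)).ne'
  rw [lintegral_mul_lintegral_ball (w := fun y => (μ (ball y ρ))⁻¹)
      (measurable_measure_ball ρ).inv hF,
    ← lintegral_const_mul' _ _ ENNReal.ofReal_ne_top]
  refine le_trans (setLIntegral_mono' measurableSet_ball fun z hz => ?_)
    (setLIntegral_le_lintegral (ball x r) _)
  have hsub : ball z ρ ⊆ ball x (r + ρ) := ball_subset_ball' (by rw [mem_ball] at hz; linarith)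
  have hle : (ENNReal.ofReal Cd)⁻¹ ≤
      ∫⁻ y in ball x (r + ρ), (ball z ρ).indicator (fun y => (μ (ball y ρ))⁻¹) y ∂μ := by
    rw [setLIntegral_indicator measurableSet_ball, Set.inter_eq_left.2 hsub]
    calc (ENNReal.ofReal Cd)⁻¹
        = (ENNReal.ofReal Cd * μ (ball z ρ))⁻¹ * μ (ball z ρ) := by
          rw [ENNReal.mul_inv (Or.inl hCd) (Or.inl ENNReal.ofReal_ne_top), mul_assoc,
            ENNReal.inv_mul_cancel (h.measure_ball_pos z hρ).ne' (h.measure_ball_lt_top z ρ).ne,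
            mul_one]
      _ = ∫⁻ _ in ball z ρ, (ENNReal.ofReal Cd * μ (ball z ρ))⁻¹ ∂μ := by
          rw [setLIntegral_const]
      _ ≤ ∫⁻ y in ball z ρ, (μ (ball y ρ))⁻¹ ∂μ := by
          refine setLIntegral_mono' measurableSet_ball fun y hy => ?_
          refine ENNReal.inv_le_inv.2 (le_trans (measure_mono ?_) (h.doubling z ρ hρ).2.1)
          exact ball_subset_ball' (by rw [mem_ball] at hy; linarith)
  calc F z = F z * (ENNReal.ofReal Cd * (ENNReal.ofReal Cd)⁻¹) := by
        rw [ENNReal.mul_inv_cancel hCd ENNReal.ofReal_ne_top, mul_one]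
    _ ≤ F z * (ENNReal.ofReal Cd *
        ∫⁻ y in ball x (r + ρ), (ball z ρ).indicator (fun y => (μ (ball y ρ))⁻¹) y ∂μ) := by
        gcongr
    _ = _ := by ring!

theorem MMS.average_le_setLIntegral_ball (h : MMS μ Cd CP lam) {F : X → ℝ≥0∞}
    (hF : AEMeasurable F μ) (x : X) (r : ℝ) {ρ : ℝ} (hρ : 0 < ρ) {n : ℕ}
    (hn : 2 * lam ≤ 2 ^ n) :
    ∫⁻ y in ball x r, (μ (ball y ρ))⁻¹ * ∫⁻ z in ball y (lam * ρ), F z ∂μ ∂μ ≤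
      ENNReal.ofReal Cd ^ n * ∫⁻ z in ball x (r + lam * ρ), F z ∂μ := by
  rw [lintegral_mul_lintegral_ball (w := fun y => (μ (ball y ρ))⁻¹)
      (measurable_measure_ball ρ).inv hF,
    ← lintegral_const_mul' _ _ (by finiteness), ← lintegral_indicator measurableSet_ball]
  refine lintegral_mono fun z => ?_
  by_cases hz : z ∈ ball x (r + lam * ρ)
  · rw [Set.indicator_of_mem hz, mul_comm]
    gcongr
    refine (setLIntegral_le_lintegral _ _).trans ?_
    rw [lintegral_indicator measurableSet_ball]
    have hpos : μ (ball z (lam * ρ)) ≠ 0 :=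
      (h.measure_ball_pos z (mul_pos (one_pos.trans_le h.hlam) hρ)).ne'
    have hfin : μ (ball z (lam * ρ)) ≠ ⊤ := (h.measure_ball_lt_top z _).ne
    calc ∫⁻ y in ball z (lam * ρ), (μ (ball y ρ))⁻¹ ∂μ
        ≤ ∫⁻ _ in ball z (lam * ρ), ENNReal.ofReal Cd ^ n * (μ (ball z (lam * ρ)))⁻¹ ∂μ := by
          refine setLIntegral_mono' measurableSet_ball fun y hy => ?_
          have hle : μ (ball z (lam * ρ)) ≤ ENNReal.ofReal Cd ^ n * μ (ball y ρ) := by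
            refine le_trans (measure_mono (ball_subset_ball' ?_))
              (h.measure_ball_two_pow_le_s6 y hρ n)
            rw [mem_ball, dist_comm] at hy
            nlinarith
          rw [ENNReal.inv_le_iff_le_mul (fun _ => (h.measure_ball_pos y hρ).ne')
            (fun e => absurd e (h.measure_ball_lt_top y ρ).ne), ← mul_assoc,
            mul_comm (μ (ball y ρ)), ← div_eq_mul_inv]
          rwa [ENNReal.le_div_iff_mul_le (Or.inl hpos) (Or.inl hfin), one_mul]
      _ = ENNReal.ofReal Cd ^ n := by
          rw [setLIntegral_const, mul_assoc, ENNReal.inv_mul_cancel hpos hfin, mul_one]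
  · rw [Set.indicator_of_notMem hz]
    have hzero : ∫⁻ y in ball x r,
        (ball z (lam * ρ)).indicator (fun y => (μ (ball y ρ))⁻¹) y ∂μ = 0 := by
      rw [setLIntegral_indicator measurableSet_ball]
      have hempty : ball z (lam * ρ) ∩ ball x r = ∅ := by
        refine Set.disjoint_iff_inter_eq_empty.1 (ball_disjoint_ball ?_)
        rw [mem_ball, not_lt] at hz
        linarith
      simp [hempty]
    exact (mul_eq_zero_of_right _ hzero).le

end Averaging

/-- A Faber-Krahn type inequality at scale `ρ`: if `f ≥ 0` vanishes on at least half of every ball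
of radius `ρ`, then its integral is at most a multiple of `ρ` times its total variation on a
slightly larger ball. -/
theorem MMS.lintegral_le_mul_tv [BorelSpace X] {μ : Measure X} {Cd CP lam : ℝ}
    (h : MMS μ Cd CP lam) {n : ℕ} (hn : 2 * lam ≤ 2 ^ n) {x : X} {r s ρ : ℝ} (hρ : 0 < ρ)
    (hrs : r + ρ + lam * ρ < s) {f : X → ℝ} (hf0 : ∀ y, 0 ≤ f y)
    (hf : AEMeasurable f (μ.restrict (ball x s)))
    (hhalf : ∀ y ∈ ball x (r + ρ), 2 * μ ({z | f z ≠ 0} ∩ ball y ρ) ≤ μ (ball y ρ))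
    {T : ℝ≥0∞} (hT : T ≠ ⊤) (htv : tv μ f (ball x s) ≤ T) :
    ∫⁻ z in ball x r, ENNReal.ofReal (f z) ∂μ ≤
      ENNReal.ofReal (3 * CP * Cd ^ (n + 1) * ρ) * T := by
  have := h.properSpace_s6
  have hfm : IsFiniteMeasureOnCompacts μ := ⟨fun K hK => by
    obtain ⟨r, hr⟩ := hK.isBounded.subset_ball x
    exact (measure_mono hr).trans_lt (h.measure_ball_lt_top x r)⟩
  obtain ⟨m, hm0, hm⟩ := h.exists_le_measure_ball x (r + ρ) hρ
  obtain ⟨t, hrt, hts⟩ := exists_between hrs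
  have hlamρ : ρ ≤ lam * ρ := le_mul_of_one_le_left hρ.le h.hlam
  set F : X → ℝ≥0∞ := (ball x s).indicator fun z => ENNReal.ofReal (f z) with hF
  have hFm : AEMeasurable F μ :=
    (aemeasurable_indicator_iff measurableSet_ball).2 hf.ennreal_ofReal
  set A := ball x (r + ρ) with hA
  set c₁ := ENNReal.ofReal Cd * (m⁻¹ * 3 * μ A) with hc₁
  set c₂ := ENNReal.ofReal (3 * CP * Cd ^ (n + 1) * ρ) with hc₂
  have hc₂' : ENNReal.ofReal Cd * (3 * ENNReal.ofReal (CP * ρ) * ENNReal.ofReal Cd ^ n) = c₂ := by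
    have hCd : 0 ≤ Cd := zero_le_one.trans h.hCd
    have hCP := h.hCP
    rw [hc₂, ← ENNReal.ofReal_pow hCd, ← ENNReal.ofReal_ofNat 3, ← ENNReal.ofReal_mul (by norm_num),
      ← ENNReal.ofReal_mul (by positivity), ← ENNReal.ofReal_mul hCd]
    congr 1
    ring
  have hc₁top : c₁ ≠ ⊤ := by
    have := (h.measure_ball_lt_top x (r + ρ)).ne
    have := ENNReal.inv_ne_top.2 hm0
    finiteness
  have step : ∀ (v : X → ℝ) (g : X → ℝ≥0∞), LocLipschitzOn v (ball x s) → Measurable g →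
      IsWeakUpperGradientOn μ g v (ball x s) → ∫⁻ z in ball x r, ENNReal.ofReal (f z) ∂μ ≤
        c₁ * ∫⁻ z in closedBall x t, ENNReal.ofReal |v z - f z| ∂μ +
          c₂ * ∫⁻ z in ball x s, g z ∂μ := by
    intro v g hv hgm hg
    set E := ∫⁻ z in closedBall x t, ENNReal.ofReal |v z - f z| ∂μ with hE
    have hvm : AEMeasurable v (μ.restrict (closedBall x t)) := by
      obtain ⟨L, hL⟩ := hv _ (isCompact_closedBall x t) (closedBall_subset_ball hts)
      exact hL.continuousOn.aemeasurable measurableSet_closedBall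
    have hlocal : ∀ y ∈ A, ∫⁻ z in ball y ρ, F z ∂μ ≤
        3 * E + 3 * ENNReal.ofReal (CP * ρ) * ∫⁻ z in ball y (lam * ρ), g z ∂μ := by
      intro y hy
      rw [hA, mem_ball] at hy
      have hsubt : ball y (lam * ρ) ⊆ ball x t := ball_subset_ball' (by linarith)
      have hsubt' : ball y ρ ⊆ closedBall x t :=
        (ball_subset_ball hlamρ).trans (hsubt.trans ball_subset_closedBall)
      have hsubs : ball y ρ ⊆ ball x s := hsubt'.trans (closedBall_subset_ball hts)
      obtain ⟨c, hc⟩ := h.exists_lintegral_sub_const_le hts hv hgm hg hρ hsubt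
      have hfy : AEMeasurable f (μ.restrict (ball y ρ)) :=
        hf.mono_measure (Measure.restrict_mono hsubs le_rfl)
      have hvy : AEMeasurable v (μ.restrict (ball y ρ)) :=
        hvm.mono_measure (Measure.restrict_mono hsubt' le_rfl)
      calc ∫⁻ z in ball y ρ, F z ∂μ = ∫⁻ z in ball y ρ, ENNReal.ofReal |f z| ∂μ := by
            refine setLIntegral_congr_fun measurableSet_ball fun z hz => ?_
            rw [hF, Set.indicator_of_mem (hsubs hz), abs_of_nonneg (hf0 z)]
        _ ≤ 3 * ∫⁻ z in ball y ρ, ENNReal.ofReal |f z - c| ∂μ := by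
            refine lintegral_le_of_measure_ne_zero_le hfy ?_ ?_ c
            · rw [Measure.restrict_apply_univ]
              exact (h.measure_ball_lt_top y ρ).ne
            · rw [Measure.restrict_apply_univ, Measure.restrict_apply' measurableSet_ball]
              exact hhalf y hy
        _ ≤ 3 * ∫⁻ z in ball y ρ,
              (ENNReal.ofReal |v z - f z| + ENNReal.ofReal |v z - c|) ∂μ := by
            refine mul_le_mul_right (lintegral_mono fun z => ?_) _
            rw [← ENNReal.ofReal_add (abs_nonneg _) (abs_nonneg _), abs_sub_comm (v z) (f z)]
            exact ENNReal.ofReal_le_ofReal (abs_sub_le _ _ _)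
        _ ≤ 3 * (E + ENNReal.ofReal (CP * ρ) * ∫⁻ z in ball y (lam * ρ), g z ∂μ) := by
            rw [lintegral_add_left' (by fun_prop)]
            gcongr
            exact lintegral_mono_set hsubt'
        _ = _ := by ring
    calc ∫⁻ z in ball x r, ENNReal.ofReal (f z) ∂μ = ∫⁻ z in ball x r, F z ∂μ := by
          refine setLIntegral_congr_fun measurableSet_ball fun z hz => ?_
          rw [hF, Set.indicator_of_mem (ball_subset_ball (by linarith) hz)]
      _ ≤ ENNReal.ofReal Cd * ∫⁻ y in A, (μ (ball y ρ))⁻¹ * ∫⁻ z in ball y ρ, F z ∂μ ∂μ :=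
          h.setLIntegral_ball_le_average hFm x r hρ
      _ ≤ ENNReal.ofReal Cd * ∫⁻ y in A, (m⁻¹ * 3 * E + 3 * ENNReal.ofReal (CP * ρ) *
            ((μ (ball y ρ))⁻¹ * ∫⁻ z in ball y (lam * ρ), g z ∂μ)) ∂μ := by
          refine mul_le_mul_right (setLIntegral_mono' measurableSet_ball fun y hy => ?_) _
          calc (μ (ball y ρ))⁻¹ * ∫⁻ z in ball y ρ, F z ∂μ
              ≤ (μ (ball y ρ))⁻¹ * (3 * E + 3 * ENNReal.ofReal (CP * ρ) *
                  ∫⁻ z in ball y (lam * ρ), g z ∂μ) := by gcongr; exact hlocal y hy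
            _ = (μ (ball y ρ))⁻¹ * (3 * E) + 3 * ENNReal.ofReal (CP * ρ) *
                  ((μ (ball y ρ))⁻¹ * ∫⁻ z in ball y (lam * ρ), g z ∂μ) := by ring
            _ ≤ _ := by
                rw [mul_assoc m⁻¹]
                gcongr
                exact hm y (ball_subset_closedBall hy)
      _ ≤ ENNReal.ofReal Cd * (m⁻¹ * 3 * E * μ A + 3 * ENNReal.ofReal (CP * ρ) *
            (ENNReal.ofReal Cd ^ n * ∫⁻ z in ball x s, g z ∂μ)) := by
          rw [lintegral_add_left measurable_const, setLIntegral_const,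
            lintegral_const_mul' _ _ (by finiteness)]
          gcongr
          refine (h.average_le_setLIntegral_ball hgm.aemeasurable x (r + ρ) hρ hn).trans ?_
          gcongr
      _ = _ := by rw [hc₁, ← hc₂']; ring
  have hlt : ∀ a, T < a → ∫⁻ z in ball x r, ENNReal.ofReal (f z) ∂μ ≤ c₂ * a := by
    intro a ha
    have hlt := htv.trans_lt ha
    simp only [tv, iInf_lt_iff] at hlt
    obtain ⟨v, hv, hvf, g, hgm, hg, hlim⟩ := hlt
    have hfreq := frequently_lt_of_liminf_lt (by isBoundedDefault) hlim
    have herr : Tendsto (fun i => c₁ * ∫⁻ z in closedBall x t, ENNReal.ofReal |v i z - f z| ∂μ)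
        atTop (𝓝 0) := by
      simpa using ENNReal.Tendsto.const_mul
        (hvf _ (isCompact_closedBall x t) (closedBall_subset_ball hts)) (Or.inr hc₁top)
    refine ENNReal.le_of_forall_pos_le_add fun ε hε _ => ?_
    obtain ⟨i, hi, hi'⟩ := (hfreq.and_eventually
      (herr.eventually_lt_const (ENNReal.coe_pos.2 hε))).exists
    refine (step (v i) (g i) (hv i) (hgm i) (hg i)).trans ?_
    rw [add_comm]
    gcongr
  have : (𝓝[>] T).NeBot := nhdsGT_neBot_of_exists_gt ⟨⊤, hT.lt_top⟩
  refine ge_of_tendsto (x := 𝓝[>] T) (ENNReal.Tendsto.const_mul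
    (tendsto_id.mono_left nhdsWithin_le_nhds) (Or.inr ENNReal.ofReal_ne_top))
    (eventually_mem_nhdsWithin.mono hlt)

/-- One step of the De Giorgi iteration. -/
theorem MMS.lintegral_max_sub_le [BorelSpace X] {μ : Measure X} {Cd CP lam : ℝ}
    (h : MMS μ Cd CP lam) {n : ℕ} (hn : 2 * lam ≤ 2 ^ n) {x : X} {r s ρ R Q M : ℝ}
    (hρ : 0 < ρ) (hgap : 4 * (1 + lam) * ρ ≤ s - r) (hsR : s ≤ R) {u : X → ℝ}
    (hu : AEMeasurable u (μ.restrict (ball x R))) {k k' α : ℝ} (hk : k < k')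
    (htv : tv μ (fun y => max (u y - k') 0) (ball x (r + (s - r) / 2)) ≤
      ENNReal.ofReal (2 / (s - (r + (s - r) / 2))) *
        ∫⁻ y in ball x s, ENNReal.ofReal (max (u y - k') 0) ∂μ)
    (hmass : ∀ y ∈ ball x R,
      ENNReal.ofReal (Cd⁻¹ ^ 2 * (ρ / R) ^ Q * M) ≤ μ (ball y ρ))
    (hsmall : 2 * α / (k' - k) ≤ Cd⁻¹ ^ 2 * (ρ / R) ^ Q * M)
    (hI : ∫⁻ y in ball x s, ENNReal.ofReal (max (u y - k) 0) ∂μ ≤ ENNReal.ofReal α) :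
    ∫⁻ y in ball x r, ENNReal.ofReal (max (u y - k') 0) ∂μ ≤
      ENNReal.ofReal (12 * CP * Cd ^ (n + 1) * ρ / (s - r) * α) := by
  have hlam := h.hlam
  have hCP := h.hCP
  have hCd : 0 < Cd := one_pos.trans_le h.hCd
  have hlamρ : ρ ≤ lam * ρ := le_mul_of_one_le_left hρ.le hlam
  have hsr : 0 < s - r := lt_of_lt_of_le (by positivity) hgap
  have hI' : ∫⁻ y in ball x s, ENNReal.ofReal (max (u y - k') 0) ∂μ ≤ ENNReal.ofReal α := by
    refine le_trans (lintegral_mono fun y => ?_) hI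
    exact ENNReal.ofReal_le_ofReal (max_le_max (by linarith) le_rfl)
  have hus : AEMeasurable u (μ.restrict (ball x s)) :=
    hu.mono_measure (Measure.restrict_mono (ball_subset_ball hsR) le_rfl)
  have hlevel : 2 * μ ({z | max (u z - k') 0 ≠ 0} ∩ ball x s) ≤
      ENNReal.ofReal (2 * α / (k' - k)) := by
    have hmk := mul_meas_ge_le_lintegral₀
      (((hus.sub_const k).max aemeasurable_const).ennreal_ofReal (f := fun y => max (u y - k) 0))
      (ENNReal.ofReal (k' - k))
    rw [mul_div_assoc, ENNReal.ofReal_mul zero_le_two, ENNReal.ofReal_ofNat,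
      ENNReal.ofReal_div_of_pos (sub_pos.2 hk)]
    gcongr
    rw [ENNReal.le_div_iff_mul_le (Or.inl (ENNReal.ofReal_pos.2 (sub_pos.2 hk)).ne')
      (Or.inl ENNReal.ofReal_ne_top), mul_comm]
    refine le_trans ?_ (hmk.trans hI)
    rw [Measure.restrict_apply' measurableSet_ball]
    refine mul_le_mul_right (measure_mono (Set.inter_subset_inter_left _ fun z hz => ?_)) _
    refine ENNReal.ofReal_le_ofReal (le_max_of_le_left ?_)
    have : ¬ u z - k' ≤ 0 := fun hle => hz (max_eq_right hle)
    linarith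
  have hT := htv.trans (mul_le_mul_right hI' _)
  refine (h.lintegral_le_mul_tv hn hρ (r := r) (by nlinarith) (fun _ => le_max_right _ _) ?_ ?_
    (by finiteness) hT).trans_eq ?_
  · exact ((hus.mono_measure (Measure.restrict_mono (ball_subset_ball (by linarith))
      le_rfl)).sub_const k').max aemeasurable_const
  · intro y hy
    have hy' := mem_ball.1 hy
    calc 2 * μ ({z | max (u z - k') 0 ≠ 0} ∩ ball y ρ)
        ≤ 2 * μ ({z | max (u z - k') 0 ≠ 0} ∩ ball x s) := by
          gcongr
          exact ball_subset_ball' (by nlinarith)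
      _ ≤ ENNReal.ofReal (2 * α / (k' - k)) := hlevel
      _ ≤ _ := ENNReal.ofReal_le_ofReal hsmall
      _ ≤ μ (ball y ρ) := hmass y (ball_subset_ball (by nlinarith) hy)
  · rw [← ENNReal.ofReal_mul (by rw [sub_add_eq_sub_sub]; apply div_nonneg <;> linarith),
      ← ENNReal.ofReal_mul (by positivity)]
    congr 1
    have : s - (r + (s - r) / 2) = (s - r) / 2 := by ring
    rw [this]
    field_simp
    ring

/-- The De Giorgi iteration: if the excess of `u` over the level `k₀` on `ball x R` is small
compared to `d`, then `u ≤ k₀ + d` almost everywhere on `ball x r`. -/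
theorem MMS.ae_le_of_deGiorgi [BorelSpace X] {μ : Measure X} {Cd CP lam : ℝ}
    (h : MMS μ Cd CP lam) {n : ℕ} (hn : 2 * lam ≤ 2 ^ n) {x : X} {r R Q M θ α d k₀ : ℝ}
    (hr : 0 < r) (hrR : r < R) (hQ : 0 < Q) {u : X → ℝ}
    (hum : AEMeasurable u (μ.restrict (ball x R))) (hα0 : 0 ≤ α) (hd0 : 0 < d) (hθ0 : 0 < θ)
    (hθK : 2 * (12 * CP * Cd ^ (n + 1)) * θ ≤ (1 / 2) ^ (Q + 1)) (hθlam : 8 * (1 + lam) * θ ≤ 1)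
    (hmass : ∀ ρ : ℝ, 0 < ρ → ρ ≤ R → ∀ y ∈ ball x R,
      ENNReal.ofReal (Cd⁻¹ ^ 2 * (ρ / R) ^ Q * M) ≤ μ (ball y ρ))
    (hlevel : 4 * α / d ≤ Cd⁻¹ ^ 2 * (θ * (R - r) / R) ^ Q * M)
    (htv : ∀ k s₁ s₂ : ℝ, k₀ ≤ k → 0 < s₁ → s₁ < s₂ → s₂ ≤ R →
      tv μ (fun y => max (u y - k) 0) (ball x s₁) ≤
        ENNReal.ofReal (2 / (s₂ - s₁)) *
          ∫⁻ y in ball x s₂, ENNReal.ofReal (max (u y - k) 0) ∂μ)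
    (hI0 : ∫⁻ y in ball x R, ENNReal.ofReal (max (u y - k₀) 0) ∂μ ≤ ENNReal.ofReal α) :
    ∀ᵐ y ∂(μ.restrict (ball x r)), u y ≤ k₀ + d := by
  have hlam := h.hlam
  have hRr : 0 < R - r := sub_pos.2 hrR
  have hR : 0 < R := hr.trans hrR
  set σ : ℝ := (1 / 2) ^ (Q + 1) with hσ
  have hσ0 : 0 < σ := by positivity
  set K : ℝ := 12 * CP * Cd ^ (n + 1) with hK
  set I : ℕ → ℝ≥0∞ := fun i => ∫⁻ y in ball x (r + (R - r) * (1 / 2) ^ i),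
    ENNReal.ofReal (max (u y - (k₀ + d * (1 - (1 / 2) ^ i))) 0) ∂μ with hI
  have hiter : ∀ i, I i ≤ ENNReal.ofReal (α * σ ^ i) := by
    intro i
    induction i with
    | zero => simpa [hI] using hI0
    | succ i ih =>
      set p : ℝ := (1 / 2) ^ i with hp
      have hp0 : 0 < p := by positivity
      have hp1 : p ≤ 1 := pow_le_one₀ (by norm_num) (by norm_num)
      have hp' : (1 / 2 : ℝ) ^ (i + 1) = p / 2 := by rw [pow_succ, hp]; ring
      simp only [hI, hp'] at ih ⊢
      have hgap : r + (R - r) * p - (r + (R - r) * (p / 2)) = (R - r) * p / 2 := by ring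
      have hgap0 : 0 < (R - r) * p / 2 := by positivity
      have hsR : r + (R - r) * p ≤ R := by nlinarith
      have hρR : θ * (R - r) * p ≤ R := by
        have : θ ≤ 1 := by nlinarith
        calc θ * (R - r) * p ≤ 1 * (R - r) * 1 := by gcongr
          _ ≤ R := by linarith
      refine (h.lintegral_max_sub_le (ρ := θ * (R - r) * p) (Q := Q) (M := M) (α := α * σ ^ i)
        hn (by positivity) ?_ hsR hum ?_ (htv _ _ _ ?_ ?_ ?_ hsR) ?_ ?_ ih).trans ?_
      · rw [hgap]
        have := mul_le_mul_of_nonneg_right hθlam hgap0.le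
        linarith
      · nlinarith
      · nlinarith
      · rw [hgap]; positivity
      · rw [hgap]; linarith
      · exact hmass _ (by positivity) hρR
      · have hpσ : σ ^ i = p ^ Q * p := by
          rw [hσ, hp, ← Real.rpow_natCast, ← Real.rpow_mul (by norm_num), mul_comm,
            Real.rpow_mul (by norm_num), Real.rpow_natCast, ← hp, Real.rpow_add hp0, Real.rpow_one]
        have hk : k₀ + d * (1 - p / 2) - (k₀ + d * (1 - p)) = d * p / 2 := by ring
        rw [hk, hpσ, mul_div_right_comm (θ * (R - r)) p, Real.mul_rpow (by positivity) hp0.le]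
        calc 2 * (α * (p ^ Q * p)) / (d * p / 2) = 4 * α / d * p ^ Q := by field_simp; ring
          _ ≤ Cd⁻¹ ^ 2 * (θ * (R - r) / R) ^ Q * M * p ^ Q := by gcongr
          _ = _ := by ring
      · refine ENNReal.ofReal_le_ofReal ?_
        rw [hgap]
        calc K * (θ * (R - r) * p) / ((R - r) * p / 2) * (α * σ ^ i)
            = 2 * K * θ * (α * σ ^ i) := by field_simp
          _ ≤ σ * (α * σ ^ i) := by gcongr
          _ = _ := by rw [pow_succ]; ring
  have hσ1 : σ < 1 := Real.rpow_lt_one (by norm_num) (by norm_num) (by linarith)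
  have hlim : Tendsto (fun i => ENNReal.ofReal (α * σ ^ i)) atTop (𝓝 0) := by
    have := (tendsto_pow_atTop_nhds_zero_of_lt_one hσ0.le hσ1).const_mul α
    simpa using ENNReal.tendsto_ofReal this
  have hzero : ∫⁻ y in ball x r, ENNReal.ofReal (max (u y - (k₀ + d)) 0) ∂μ = 0 := by
    refine le_antisymm (ge_of_tendsto' hlim fun i => le_trans ?_ (hiter i)) zero_le
    have hp0 : (0 : ℝ) ≤ (1 / 2) ^ i := by positivity
    refine lintegral_mono' (Measure.restrict_mono (ball_subset_ball ?_) le_rfl) fun y => ?_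
    · nlinarith
    · exact ENNReal.ofReal_le_ofReal (max_le_max (by nlinarith) le_rfl)
  have hur : AEMeasurable u (μ.restrict (ball x r)) :=
    hum.mono_measure (Measure.restrict_mono (ball_subset_ball hrR.le) le_rfl)
  rw [lintegral_eq_zero_iff' (by fun_prop)] at hzero
  filter_upwards [hzero] with y hy
  have := ENNReal.ofReal_eq_zero.1 hy
  linarith [le_max_left (u y - (k₀ + d)) 0]

/-- **Weak Harnack inequality.** Let `u ∈ BV(B(x,R))` satisfy the De Giorgi class inequality
for all `0 < s₁ < s₂ ≤ R < (1/4) diam X` and all levels `k ≥ k*`. Then for every `k₀ ≥ k*`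
and `0 < r < R`,
`esssup_{B(x,r)} u ≤ C₁ (R/(R-r))^Q ⨍_{B(x,R)} (u-k₀)₊ dμ + k₀`,
where `C₁` depends only on the structural constants. -/
theorem weak_harnack_inequality :
    ∀ (Cd CP lam Q : ℝ), ∃ C₁ : ℝ, 0 < C₁ ∧
      ∀ (X : Type*) [MetricSpace X] [MeasurableSpace X] [BorelSpace X]
        (μ : Measure X), MMS μ Cd CP lam →
        1 < Q →
        (∀ (x y : X) (r R : ℝ), 0 < r → r ≤ R → y ∈ Metric.ball x R →
          ENNReal.ofReal (Cd⁻¹ ^ 2 * (r / R) ^ Q) ≤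
            μ (Metric.ball y r) / μ (Metric.ball x R)) →
        ∀ (x : X) (R : ℝ) (u : X → ℝ) (kstar : ℝ),
          0 < R → ENNReal.ofReal R < EMetric.diam (Set.univ : Set X) / 4 →
          MemBV μ u (Metric.ball x R) →
          (∀ k s₁ s₂ : ℝ, kstar ≤ k → 0 < s₁ → s₁ < s₂ → s₂ ≤ R →
            tv μ (fun y => max (u y - k) 0) (Metric.ball x s₁) ≤
              ENNReal.ofReal (2 / (s₂ - s₁)) *
                ∫⁻ y in Metric.ball x s₂, ENNReal.ofReal (max (u y - k) 0) ∂μ) →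
          ∀ (k₀ r : ℝ), kstar ≤ k₀ → 0 < r → r < R →
            essSup (fun y => (u y : EReal)) (μ.restrict (Metric.ball x r)) ≤
              ((C₁ * (R / (R - r)) ^ Q *
                  (⨍ y in Metric.ball x R, max (u y - k₀) 0 ∂μ) + k₀ : ℝ) : EReal) := by
  intro Cd CP lam Q
  by_cases hconst : 1 ≤ Cd ∧ 0 < CP ∧ 1 ≤ lam
  swap
  · exact ⟨1, one_pos, fun X _ _ _ μ h => absurd ⟨h.hCd, h.hCP, h.hlam⟩ hconst⟩
  obtain ⟨hCd, hCP, hlam⟩ := hconst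
  have hCd0 : 0 < Cd := one_pos.trans_le hCd
  obtain ⟨n, hn⟩ := pow_unbounded_of_one_lt (2 * lam) (one_lt_two : (1 : ℝ) < 2)
  set σ : ℝ := (1 / 2) ^ (Q + 1) with hσ
  have hσ0 : 0 < σ := by positivity
  set K : ℝ := 12 * CP * Cd ^ (n + 1) with hK
  have hK0 : 0 < K := by positivity
  set θ : ℝ := min (σ / (2 * K)) (1 / (8 * (1 + lam))) with hθ
  have hθ0 : 0 < θ := by positivity
  have hθK : 2 * K * θ ≤ σ := by
    have := min_le_left (σ / (2 * K)) (1 / (8 * (1 + lam)))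
    rw [← hθ, le_div_iff₀ (by positivity)] at this
    linarith
  have hθlam : 8 * (1 + lam) * θ ≤ 1 := by
    have := min_le_right (σ / (2 * K)) (1 / (8 * (1 + lam)))
    rw [← hθ, le_div_iff₀ (by positivity)] at this
    linarith
  refine ⟨4 * Cd ^ 2 * (θ ^ Q)⁻¹, by positivity, ?_⟩
  intro X _ _ _ μ h hQ hmass x R u kstar hR _ hu htv k₀ r hk₀ hr hrR
  have hum : AEMeasurable u (μ.restrict (ball x R)) := hu.1.aemeasurable
  have hMpos := h.measure_ball_pos x hR
  have hMfin := h.measure_ball_lt_top x R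
  set M : ℝ := μ.real (ball x R) with hM
  have hM0 : 0 < M := ENNReal.toReal_pos hMpos.ne' hMfin.ne
  have hMeq : ENNReal.ofReal M = μ (ball x R) := ENNReal.ofReal_toReal hMfin.ne
  set α : ℝ := ∫ y in ball x R, max (u y - k₀) 0 ∂μ with hα
  have hα0 : 0 ≤ α := integral_nonneg fun _ => le_max_right _ _
  have : IsFiniteMeasure (μ.restrict (ball x R)) := ⟨by rwa [Measure.restrict_apply_univ]⟩
  have hint : Integrable (fun y => max (u y - k₀) 0) (μ.restrict (ball x R)) :=
    (hu.1.sub (integrable_const k₀)).pos_part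
  have hαI : ENNReal.ofReal α = ∫⁻ y in ball x R, ENNReal.ofReal (max (u y - k₀) 0) ∂μ :=
    ofReal_integral_eq_lintegral_ofReal hint (Eventually.of_forall fun _ => le_max_right _ _)
  have hRr : 0 < R - r := sub_pos.2 hrR
  have havg : ⨍ y in ball x R, max (u y - k₀) 0 ∂μ = M⁻¹ * α := by
    rw [setAverage_eq, smul_eq_mul]
  rw [havg]
  set D : ℝ := 4 * Cd ^ 2 * (θ ^ Q)⁻¹ * (R / (R - r)) ^ Q * (M⁻¹ * α) with hD
  have hD0 : 0 ≤ D := by positivity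
  suffices hmain : ∀ d : ℝ, D < d → ∀ᵐ y ∂(μ.restrict (ball x r)), u y ≤ k₀ + d by
    refine essSup_le_of_ae_le _ ?_
    have hseq : ∀ᵐ y ∂(μ.restrict (ball x r)), ∀ j : ℕ, u y ≤ k₀ + (D + 1 / ((j : ℝ) + 1)) :=
      ae_all_iff.2 fun j => hmain _ (lt_add_of_pos_right _ (by positivity))
    filter_upwards [hseq] with y hy
    refine EReal.coe_le_coe_iff.2 ?_
    have hlim : Tendsto (fun j : ℕ => k₀ + (D + 1 / ((j : ℝ) + 1))) atTop (𝓝 (k₀ + (D + 0))) :=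
      tendsto_const_nhds.add (tendsto_const_nhds.add tendsto_one_div_add_atTop_nhds_zero_nat)
    rw [add_zero, add_comm] at hlim
    exact ge_of_tendsto' hlim hy
  intro d hd
  have hd0 : 0 < d := hD0.trans_lt hd
  have hlevel : 4 * α / d ≤ Cd⁻¹ ^ 2 * (θ * (R - r) / R) ^ Q * M := by
    rw [div_le_iff₀ hd0]
    have heq : 4 * α = Cd⁻¹ ^ 2 * (θ * (R - r) / R) ^ Q * M * D := by
      rw [hD, mul_div_assoc, Real.mul_rpow hθ0.le (by positivity), Real.div_rpow hRr.le hR.le,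
        Real.div_rpow hR.le hRr.le]
      field_simp
    rw [heq]
    gcongr
  refine h.ae_le_of_deGiorgi hn.le hr hrR (one_pos.trans hQ) hum hα0 hd0 hθ0 hθK hθlam ?_
    hlevel (fun k s₁ s₂ hk => htv k s₁ s₂ (hk₀.trans hk)) hαI.ge
  intro ρ hρ hρR y hy
  rw [ENNReal.ofReal_mul (by positivity), hMeq,
    ← ENNReal.le_div_iff_mul_le (Or.inl hMpos.ne') (Or.inl hMfin.ne)]
  exact hmass x y ρ R hρ hρR hy

end MetricBV
end
end
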